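/- For every number field K (i.e., every subfield of the algebraic closure of ℚ that is finite-dimensional over ℚ), the set of subfields F of the algebraic closure of ℚ with K ⊆ F such that the subset K of F is definable by a first-order formula in the language of rings with parameters from F is a meager subset of the space 𝓔 of all subfields of the algebraic closure of ℚ. -/

import Mathlib

open FirstOrder Topology

noncomputable section

/-- `Q̄`, the algebraic closure of `ℚ`. -/
abbrev Qbar : Type := AlgebraicClosure ℚ

/-- `Prop` with the discrete two-point topology. -/
def propDiscrete : TopologicalSpace Prop := ⊥

/-- The product topology on the powerset `2^Q̄`, identified with `Set Q̄ = Q̄ → Prop`,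
where each factor `Prop` carries the discrete two-point topology. -/
def powersetTopology : TopologicalSpace (Set Qbar) :=
  @Pi.topologicalSpace Qbar (fun _ => Prop) (fun _ => propDiscrete)

/-- The space `𝓔` of all subfields of `Q̄`, with the subspace topology induced from `2^Q̄`
via the identification of a subfield with its underlying set of elements. -/
instance subfieldTopology : TopologicalSpace (Subfield Qbar) :=
  powersetTopology.induced (fun F => (F : Set Qbar))

/-- A subset `s` of a field `F` is definable (with parameters) if it is the solution set in `F`
of a first-order formula in the language of rings with parameters from `F`. -/
def DefinableIn (F : Type*) [Field F] (s : Set F) : Prop :=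
  letI := FirstOrder.Ring.compatibleRingOfRing F
  Set.Definable₁ (Set.univ : Set F) FirstOrder.Language.ring s

/-- The subset `ℤ` of a field `F`. -/
def intSet (F : Type*) [Field F] : Set F := Set.range (Int.cast : ℤ → F)

/-- The ring of integers `𝒪_F` of `F`: the integral closure of `ℤ` in `F`. -/
def ringOfIntegers (F : Type*) [Field F] : Set F := {x : F | IsIntegral ℤ x}

section
open Polynomial

/-- `s.card` distinct natural numbers sum to at least `0 + 1 + ⋯ + (s.card - 1)`. -/
theorem card_choose_two_le_sum (s : Finset ℕ) : s.card.choose 2 ≤ ∑ i ∈ s, i := by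
  induction s using Finset.induction_on_max with
  | empty => simp
  | insert a s h ih =>
    have ha : a ∉ s := fun h' => lt_irrefl _ (h a h')
    rw [Finset.card_insert_of_notMem ha, Finset.sum_insert ha, Nat.choose_succ_left _ _ (by norm_num)]
    have : s.card ≤ a := by
      have : s ⊆ Finset.range a := fun x hx => Finset.mem_range.2 (h x hx)
      simpa using Finset.card_le_card this
    simp
    omega

/-- A determinant of polynomials evaluated at multiples of `q` is highly divisible by `q`. -/
theorem pow_dvd_det_eval {R ι : Type*} [CommRing R] [Fintype ι] [DecidableEq ι]
    (q : R) (θ : ι → R[X]) (s : ι → R) :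
    q ^ ((Fintype.card ι).choose 2) ∣
      Matrix.det (Matrix.of fun l r => (θ l).eval (q * s r)) := by
  obtain ⟨N, hN⟩ : ∃ N, ∀ l, (θ l).natDegree < N :=
    ⟨∑ l, (θ l).natDegree + 1, fun l => Nat.lt_succ_of_le
      (Finset.single_le_sum (f := fun l => (θ l).natDegree) (by simp) (Finset.mem_univ l))⟩
  have hrow : (Matrix.of fun l r => (θ l).eval (q * s r)) =
      fun l => ∑ j : Fin N, ((θ l).coeff j * q ^ (j : ℕ)) • (fun r => s r ^ (j : ℕ)) := by
    ext l r
    rw [Matrix.of_apply, eval_eq_sum_range' (hN l), Finset.sum_apply, Finset.sum_range]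
    refine Finset.sum_congr rfl fun j _ => ?_
    simp only [Pi.smul_apply, smul_eq_mul]
    ring
  have hdet : Matrix.det (Matrix.of fun l r => (θ l).eval (q * s r)) =
      Matrix.detRowAlternating (R := R) (n := ι) (fun l => ∑ j : Fin N,
        ((θ l).coeff j * q ^ (j : ℕ)) • (fun r => s r ^ (j : ℕ))) := by
    rw [← hrow]; rfl
  rw [hdet, ← AlternatingMap.coe_multilinearMap, MultilinearMap.map_sum]
  refine Finset.dvd_sum fun f _ => ?_
  rw [MultilinearMap.map_smul_univ]
  by_cases hf : Function.Injective f
  · rw [Finset.prod_mul_distrib, Finset.prod_pow_eq_pow_sum, smul_eq_mul]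
    refine dvd_mul_of_dvd_left (dvd_mul_of_dvd_right (pow_dvd_pow _ ?_) _) _
    have hinj : Function.Injective (fun l => (f l : ℕ)) := Fin.val_injective.comp hf
    have := card_choose_two_le_sum (Finset.univ.image fun l => (f l : ℕ))
    rwa [Finset.card_image_of_injective _ hinj, Finset.sum_image (fun _ _ _ _ h => hinj h),
      Finset.card_univ] at this
  · obtain ⟨a, b, hab, hne⟩ : ∃ a b, f a = f b ∧ a ≠ b := by
      simpa [Function.Injective] using hf
    rw [AlternatingMap.coe_multilinearMap,
      AlternatingMap.map_eq_zero_of_eq _ _ (i := a) (j := b) (by simp [hab]) hne]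
    simp

/-- Determinants of matrices that are `q ^ d`-adically close to polynomial values at multiples
of `q`. -/
theorem pow_dvd_det_of_approx {R ι : Type*} [CommRing R] [Fintype ι] [DecidableEq ι]
    (q : R) (θ : ι → R[X]) (s : ι → R) (M : Matrix ι ι R)
    (h : ∀ l r, q ^ ((Fintype.card ι).choose 2) ∣ M l r - (θ l).eval (q * s r)) :
    q ^ ((Fintype.card ι).choose 2) ∣ M.det := by
  set e := (Fintype.card ι).choose 2
  have h1 := pow_dvd_det_eval q θ s
  rw [← Ideal.mem_span_singleton, ← Ideal.Quotient.eq_zero_iff_mem, RingHom.map_det] at h1 ⊢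
  rw [← h1]
  congr 1
  ext l r
  simp only [RingHom.mapMatrix_apply, Matrix.map_apply, Matrix.of_apply]
  rw [Ideal.Quotient.eq, Ideal.mem_span_singleton]
  exact h l r

/-- Polynomial approximations of the branch of `f = 0` through a simple root modulo `p`. -/
theorem exists_approx_root {R : Type*} [CommRing R] (f : R[X][X]) (p t₁ x₁ a : R)
    (ha : p ∣ 1 - a * (derivative f).evalEval t₁ x₁) (k : ℕ) :
    ∃ ψ : R[X], ∀ v x : R, p ∣ v → p ∣ x₁ - x → f.evalEval (t₁ + v) x = 0 →
      p ^ (k + 1) ∣ ψ.eval v - x := by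
  induction k with
  | zero => exact ⟨C x₁, fun v x _ hx _ => by simpa using hx⟩
  | succ k ih =>
    obtain ⟨ψ, hψ⟩ := ih
    refine ⟨ψ - C a * (f.map (mapRingHom (C : R →+* R[X]))).evalEval (C t₁ + X) ψ,
      fun v x hv hx hf => ?_⟩
    have h1 : ((f.map (mapRingHom (C : R →+* R[X]))).evalEval (C t₁ + X) ψ).eval v =
        f.evalEval (t₁ + v) (ψ.eval v) := by
      have := map_mapRingHom_evalEval (evalRingHom v) (C t₁ + X) ψ
        (p := f.map (mapRingHom (C : R →+* R[X])))
      rw [Polynomial.map_map, mapRingHom_comp] at this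
      have hc : (evalRingHom v).comp (C : R →+* R[X]) = RingHom.id R := by ext; simp
      rw [hc, mapRingHom_id, Polynomial.map_id] at this
      simpa using this.symm
    obtain ⟨w, hw⟩ := hψ v x hv hx hf
    have hcong : p ∣ (derivative f).evalEval t₁ x₁ - (derivative f).evalEval (t₁ + v) x := by
      rw [← Ideal.mem_span_singleton, ← Ideal.Quotient.eq_zero_iff_mem, map_sub,
        ← map_mapRingHom_evalEval, ← map_mapRingHom_evalEval, map_add]
      have e1 : Ideal.Quotient.mk (Ideal.span {p}) v = 0 := by
        rwa [Ideal.Quotient.eq_zero_iff_mem, Ideal.mem_span_singleton]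
      have e2 : Ideal.Quotient.mk (Ideal.span {p}) x₁ = Ideal.Quotient.mk (Ideal.span {p}) x := by
        rwa [Ideal.Quotient.eq, Ideal.mem_span_singleton]
      rw [e1, e2, add_zero, sub_self]
    have hexp := binomExpansion (f.map (evalRingHom (t₁ + v))) x (ψ.eval v - x)
    obtain ⟨c, hc⟩ := hexp
    rw [add_sub_cancel, derivative_map] at hc
    simp only [map_evalRingHom_eval] at hc
    rw [hf] at hc
    rw [eval_sub, eval_mul, eval_C, h1, hc]
    obtain ⟨b, hb⟩ := ha
    obtain ⟨d, hd⟩ := hcong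
    rw [hw]
    have : ψ.eval v = x + p ^ (k + 1) * w := by rw [← hw]; ring
    rw [this]
    refine ⟨w * (b + a * d) - a * c * w ^ 2 * p ^ k, ?_⟩
    generalize (derivative f).evalEval (t₁ + v) x = G at *
    generalize (derivative f).evalEval t₁ x₁ = G1 at *
    have hG : G = G1 - p * d := by rw [← hd]; ring
    have hb' : (1 : R) = a * G1 + p * b := by rw [← hb]; ring
    rw [hG]
    linear_combination (p ^ (k + 1) * w) * hb'

end

section
open Polynomial

theorem exists_norm_eval_le (p : ℂ[X]) :
    ∃ (C : ℝ) (c : ℕ), 0 ≤ C ∧ ∀ t : ℂ, ‖p.eval t‖ ≤ C * (1 + ‖t‖) ^ c := by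
  refine ⟨∑ i ∈ Finset.range (p.natDegree + 1), ‖p.coeff i‖, p.natDegree,
    Finset.sum_nonneg fun _ _ => norm_nonneg _, fun t => ?_⟩
  rw [eval_eq_sum_range, Finset.sum_mul]
  refine (norm_sum_le _ _).trans (Finset.sum_le_sum fun i hi => ?_)
  rw [norm_mul, norm_pow]
  gcongr
  refine (pow_le_pow_left₀ (norm_nonneg _) (by linarith) i).trans
    (pow_le_pow_right₀ (by linarith [norm_nonneg t]) (Nat.lt_succ_iff.1 (Finset.mem_range.1 hi)))

theorem exists_norm_root_le (g : ℂ[X][X]) (hg : g.Monic) :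
    ∃ (C : ℝ) (c : ℕ), 0 ≤ C ∧
      ∀ t x : ℂ, g.evalEval t x = 0 → ‖x‖ ≤ C * (1 + ‖t‖) ^ c := by
  choose C c hC h using fun j => exists_norm_eval_le (g.coeff j)
  refine ⟨∑ j ∈ Finset.range g.natDegree, C j + 1, ∑ j ∈ Finset.range g.natDegree, c j,
    add_nonneg (Finset.sum_nonneg fun j _ => hC j) zero_le_one, fun t x hx => ?_⟩
  have hm : (g.map (evalRingHom t)).Monic := hg.map _
  have hroot : (g.map (evalRingHom t)).IsRoot x := by
    rwa [IsRoot, map_evalRingHom_eval]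
  have hb := (hroot.norm_lt_cauchyBound hm.ne_zero).le
  have h1 : (1 : ℝ) ≤ (1 + ‖t‖) ^ (∑ j ∈ Finset.range g.natDegree, c j) :=
    one_le_pow₀ (by linarith [norm_nonneg t])
  have hsup : cauchyBound (g.map (evalRingHom t)) ≤
      ∑ j ∈ Finset.range g.natDegree, ‖(g.coeff j).eval t‖₊ + 1 := by
    rw [cauchyBound, hm.leadingCoeff, nnnorm_one, div_one, hg.natDegree_map]
    gcongr
    refine Finset.sup_le fun j hj => ?_
    rw [coeff_map, coe_evalRingHom]
    exact Finset.single_le_sum (f := fun j => ‖(g.coeff j).eval t‖₊) (fun _ _ => zero_le) hj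
  calc ‖x‖ ≤ ∑ j ∈ Finset.range g.natDegree, ‖(g.coeff j).eval t‖ + 1 := by
        have := hb.trans hsup
        have := NNReal.coe_le_coe.2 this
        push_cast at this
        exact this
    _ ≤ ∑ j ∈ Finset.range g.natDegree, C j * (1 + ‖t‖) ^ (∑ j ∈ Finset.range g.natDegree, c j)
        + 1 * (1 + ‖t‖) ^ (∑ j ∈ Finset.range g.natDegree, c j) := by
        rw [one_mul]
        gcongr with j hj
        refine (h j t).trans (mul_le_mul_of_nonneg_left ?_ (hC j))
        exact pow_le_pow_right₀ (by linarith [norm_nonneg t])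
          (Finset.single_le_sum (f := c) (fun _ _ => Nat.zero_le _) hj)
    _ = _ := by rw [add_mul, Finset.sum_mul]

theorem exists_norm_root_le_of_numberField {E : Type*} [Field E] [NumberField E]
    (f : (NumberField.RingOfIntegers E)[X][X]) (hf : f.Monic) :
    ∃ (C : ℝ) (c : ℕ), 1 ≤ C ∧ ∀ (σ : E →+* ℂ) (t : ℤ) (x : NumberField.RingOfIntegers E),
      f.evalEval (t : NumberField.RingOfIntegers E) x = 0 →
        ‖σ (x : E)‖ ≤ C * (1 + |(t : ℝ)|) ^ c := by
  have key (σ : E →+* ℂ) := exists_norm_root_le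
    (f.map (mapRingHom (σ.comp (algebraMap (NumberField.RingOfIntegers E) E)))) (hf.map _)
  choose C c hC h using key
  refine ⟨∑ σ, C σ + 1, ∑ σ, c σ, by linarith [Finset.sum_nonneg fun σ (_ : σ ∈ Finset.univ) => hC σ],
    fun σ t x hx => ?_⟩
  have h1 := h σ (t : ℂ) (σ (x : E)) (by
    have := map_mapRingHom_evalEval (σ.comp (algebraMap (NumberField.RingOfIntegers E) E))
      (t : NumberField.RingOfIntegers E) x (p := f)
    rw [hx, map_zero] at this
    simpa using this)
  have h2 : ‖(t : ℂ)‖ = |(t : ℝ)| := by simp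
  rw [h2] at h1
  have ht : (1 : ℝ) ≤ 1 + |(t : ℝ)| := by linarith [abs_nonneg (t : ℝ)]
  refine h1.trans (mul_le_mul ?_ (pow_le_pow_right₀ ht
    (Finset.single_le_sum (f := c) (fun _ _ => Nat.zero_le _) (Finset.mem_univ σ)))
    (by positivity) (by linarith [Finset.sum_nonneg fun σ (_ : σ ∈ Finset.univ) => hC σ]))
  linarith [Finset.single_le_sum (f := C) (fun σ _ => hC σ) (Finset.mem_univ σ)]

theorem norm_det_le_card_mul_prod {ι : Type*} [Fintype ι] [DecidableEq ι]
    (M : Matrix ι ι ℂ) (B : ι → ℝ) (h : ∀ l r, ‖M l r‖ ≤ B l) :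
    ‖M.det‖ ≤ (Fintype.card ι).factorial * ∏ l, B l := by
  rw [← Matrix.det_transpose, Matrix.det_apply]
  refine (norm_sum_le _ _).trans ?_
  rw [← Fintype.card_perm, ← nsmul_eq_mul, ← Finset.card_univ]
  refine Finset.sum_le_card_nsmul _ _ _ fun τ _ => ?_
  have : ‖Equiv.Perm.sign τ • ∏ i, M.transpose (τ i) i‖ = ∏ i, ‖M i (τ i)‖ := by
    rcases Int.units_eq_one_or (Equiv.Perm.sign τ) with h | h <;> simp [h, norm_prod]
  rw [this]
  exact Finset.prod_le_prod (fun _ _ => norm_nonneg _) fun i _ => h i _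

/-- An algebraic integer all of whose conjugates are smaller than a rational integer dividing it
is zero. -/
theorem eq_zero_of_dvd_of_norm_lt {E : Type*} [Field E] [NumberField E]
    (x : NumberField.RingOfIntegers E) (n : ℕ) (hn : (n : NumberField.RingOfIntegers E) ∣ x)
    (h : ∀ σ : E →+* ℂ, ‖σ (x : E)‖ < n) : x = 0 := by
  obtain ⟨y, rfl⟩ := hn
  by_cases hy : y = 0
  · simp [hy]
  exfalso
  obtain ⟨w⟩ : Nonempty (NumberField.InfinitePlace E) := inferInstance
  have hlt : ∀ v : NumberField.InfinitePlace E, v (y : E) < 1 := fun v => by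
    have h1 := h v.embedding
    simp only [map_mul, map_natCast, norm_mul, Complex.norm_natCast] at h1
    have : 0 < (n : ℝ) := by
      rcases Nat.eq_zero_or_pos n with h0 | h0
      · simp [h0] at h1
      · exact_mod_cast h0
    rw [NumberField.InfinitePlace.norm_embedding_eq] at h1
    nlinarith
  exact absurd (NumberField.InfinitePlace.one_le_of_lt_one hy fun v _ => hlt v)
    (not_le.2 (hlt w))

end

section
open Polynomial

theorem prod_monomial_bound (Y C : ℝ) (c : ℕ) :
    ∏ l : Fin (3 * c + 1) × Fin 2, Y ^ (l.1 : ℕ) * (C * Y ^ c) ^ (l.2 : ℕ) =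
      C ^ (3 * c + 1) * Y ^ ((3 * c + 1) * (4 * c)) := by
  rw [Fintype.prod_prod_type]
  simp only [Fin.prod_univ_two, Fin.val_zero, Fin.val_one, pow_zero, pow_one, mul_one]
  rw [Finset.prod_mul_distrib, Finset.prod_mul_distrib, Finset.prod_const, Finset.card_univ,
    Fintype.card_fin, Finset.prod_pow_eq_pow_sum, mul_pow, ← pow_mul]
  have hsum : (∑ i : Fin (3 * c + 1), (i : ℕ)) * 2 = (3 * c + 1) * (3 * c) := by
    rw [Fin.sum_univ_eq_sum_range (fun i => i), Finset.sum_range_id_mul_two]; simp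
  have : (3 * c + 1) * (4 * c) = (∑ i : Fin (3 * c + 1), (i : ℕ)) +
      ((∑ i : Fin (3 * c + 1), (i : ℕ)) + c * (3 * c + 1)) := by linarith
  rw [this, pow_add, pow_add]
  ring

/-- Determinant method: the matrix of the monomials `T ^ i * Y ^ j` (`j < 2`) at integral points of
`f = 0` lying in one residue class modulo `p ^ (2 * n)` and of height at most `p ^ (3 * n)` is
singular for large `n`. -/
theorem exists_det_monomials_eq_zero {E : Type*} [Field E] [NumberField E]
    (f : (NumberField.RingOfIntegers E)[X][X]) (hf : f.Monic) (t₀ : ℤ) (p : ℕ) (hp : 2 ≤ p) :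
    ∃ k n₀ : ℕ, ∀ n ≥ n₀, ∀ (u₁ : ℕ) (x₁ a : NumberField.RingOfIntegers E),
      (p : NumberField.RingOfIntegers E) ∣ 1 - a * (derivative f).evalEval
        ((t₀ + p * u₁ : ℤ) : NumberField.RingOfIntegers E) x₁ →
      ∀ (u : Fin (k + 1) × Fin 2 → ℕ) (x : Fin (k + 1) × Fin 2 → NumberField.RingOfIntegers E),
        (∀ r, u r < p ^ (3 * n)) → (∀ r, u r ≡ u₁ [MOD p ^ (2 * n)]) →
        (∀ r, f.evalEval ((t₀ + p * u r : ℤ) : NumberField.RingOfIntegers E) (x r) = 0) →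
        (∀ r, (p : NumberField.RingOfIntegers E) ∣ x₁ - x r) →
        Matrix.det (Matrix.of fun (l r : Fin (k + 1) × Fin 2) =>
          ((t₀ + p * u r : ℤ) : NumberField.RingOfIntegers E) ^ (l.1 : ℕ) * x r ^ (l.2 : ℕ)) = 0 := by
  obtain ⟨C, c, hC, hbd⟩ := exists_norm_root_le_of_numberField f hf
  set k := 3 * c with hk
  set A : ℝ := 1 + |(t₀ : ℝ)| + p with hA
  have hA1 : 1 ≤ A := by have := abs_nonneg (t₀ : ℝ); have : (0 : ℝ) ≤ p := by positivity
                         linarith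
  set Q : ℝ := (Fintype.card (Fin (k + 1) × Fin 2)).factorial *
    (C ^ (k + 1) * A ^ ((3 * c + 1) * (4 * c))) with hQ
  obtain ⟨n₀, hn₀⟩ := pow_unbounded_of_one_lt Q (one_lt_two : (1 : ℝ) < 2)
  refine ⟨k, n₀, fun n hn u₁ x₁ a ha u x hu huu hx hxx => ?_⟩
  have hcard : (Fintype.card (Fin (k + 1) × Fin 2)).choose 2 = (3 * c + 1) * (6 * c + 1) := by
    rw [Fintype.card_prod, Fintype.card_fin, Fintype.card_fin, Nat.choose_two_right, hk]
    have : (3 * c + 1) * 2 * ((3 * c + 1) * 2 - 1) = ((3 * c + 1) * (6 * c + 1)) * 2 := by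
      have : (3 * c + 1) * 2 - 1 = 6 * c + 1 := by omega
      rw [this]; ring
    rw [this, Nat.mul_div_cancel _ two_pos]
  apply eq_zero_of_dvd_of_norm_lt _ ((p ^ (2 * n)) ^ ((3 * c + 1) * (6 * c + 1)))
  · obtain ⟨ψ, hψ⟩ := exists_approx_root f p _ x₁ a ha ((2 * n) * ((3 * c + 1) * (6 * c + 1)))
    have hs (r) : ∃ s : ℤ, (u r : ℤ) - u₁ = p ^ (2 * n) * s := by
      have := (huu r).symm.dvd
      push_cast at this
      exact this
    choose s hs using hs
    have ht (r) : ((t₀ + p * u r : ℤ) : NumberField.RingOfIntegers E) =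
        ((t₀ + p * u₁ : ℤ) : NumberField.RingOfIntegers E) +
          (p : NumberField.RingOfIntegers E) ^ (2 * n) * (p * s r) := by
      have : (t₀ + p * u r : ℤ) = (t₀ + p * u₁ : ℤ) + p ^ (2 * n) * (p * s r) := by
        linear_combination (p : ℤ) * hs r
      rw [this]; push_cast; ring
    rw [← hcard, Nat.cast_pow, Nat.cast_pow]
    refine pow_dvd_det_of_approx _
      (fun l => (Polynomial.C ((t₀ + p * u₁ : ℤ) : NumberField.RingOfIntegers E) + Polynomial.X) ^ (l.1 : ℕ) *
        ψ ^ (l.2 : ℕ)) (fun r => (p * s r : NumberField.RingOfIntegers E)) _ fun l r => ?_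
    rw [hcard, Matrix.of_apply, eval_mul, eval_pow, eval_pow, eval_add, eval_C, eval_X, ht r,
      ← mul_sub]
    refine dvd_mul_of_dvd_right (dvd_trans ?_ (sub_dvd_pow_sub_pow _ _ _)) _
    rw [← dvd_neg, neg_sub]
    have := hψ ((p : NumberField.RingOfIntegers E) ^ (2 * n) * (p * s r)) (x r)
      (Dvd.intro_left ((p : NumberField.RingOfIntegers E) ^ (2 * n) * s r) (by ring))
      (hxx r) (by rw [← ht r]; exact hx r)
    rw [← pow_mul]
    exact (pow_dvd_pow _ (Nat.le_succ _)).trans this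
  · intro σ
    set X : ℝ := (p : ℝ) ^ (3 * n) with hX
    have hp1 : (1 : ℝ) ≤ p := by exact_mod_cast (by omega : 1 ≤ p)
    have hX1 : 1 ≤ X := one_le_pow₀ hp1
    have hAX : 1 ≤ A * X := one_le_mul_of_one_le_of_one_le hA1 hX1
    have htr (r) : 1 + |((t₀ + p * u r : ℤ) : ℝ)| ≤ A * X := by
      have h1 : (u r : ℝ) ≤ X := by rw [hX]; exact_mod_cast (hu r).le
      push_cast
      have h2 := abs_add_le (t₀ : ℝ) (p * u r)
      have h3 : |(p : ℝ) * u r| = p * u r := abs_of_nonneg (by positivity)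
      have h4 : (p : ℝ) * u r ≤ p * X := by gcongr
      have h5 := abs_nonneg (t₀ : ℝ)
      nlinarith
    have hentry (l r : Fin (k + 1) × Fin 2) :
        ‖σ ((((t₀ + p * u r : ℤ) : NumberField.RingOfIntegers E) ^ (l.1 : ℕ) *
          x r ^ (l.2 : ℕ) : NumberField.RingOfIntegers E) : E)‖ ≤
          (A * X) ^ (l.1 : ℕ) * (C * (A * X) ^ c) ^ (l.2 : ℕ) := by
      simp only [map_mul, map_pow, norm_mul, norm_pow, map_intCast]
      gcongr
      · have := htr r
        have h' : ‖((t₀ + p * u r : ℤ) : ℂ)‖ = |((t₀ + p * u r : ℤ) : ℝ)| := by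
          rw [Complex.norm_intCast]
        rw [h']; linarith
      · exact (hbd σ _ (x r) (hx r)).trans (by gcongr; exact htr r)
    have hdet := norm_det_le_card_mul_prod
      ((σ.comp (algebraMap (NumberField.RingOfIntegers E) E)).mapMatrix (Matrix.of
        fun (l r : Fin (k + 1) × Fin 2) => ((t₀ + p * u r : ℤ) : NumberField.RingOfIntegers E) ^
          (l.1 : ℕ) * x r ^ (l.2 : ℕ))) _ hentry
    rw [← RingHom.map_det] at hdet
    have hprod : ∏ l : Fin (k + 1) × Fin 2, (A * X) ^ (l.1 : ℕ) * (C * (A * X) ^ c) ^ (l.2 : ℕ) =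
        C ^ (k + 1) * (A * X) ^ ((3 * c + 1) * (4 * c)) := by
      exact prod_monomial_bound _ _ _
    rw [hprod] at hdet
    refine hdet.trans_lt ?_
    have hQn : Q < (p : ℝ) ^ (2 * n * (3 * c + 1)) := by
      refine hn₀.trans_le ?_
      calc (2 : ℝ) ^ n₀ ≤ (p : ℝ) ^ n₀ := by gcongr; exact_mod_cast hp
        _ ≤ _ := pow_le_pow_right₀ hp1 (by nlinarith)
    have e1 : (A * X) ^ ((3 * c + 1) * (4 * c)) =
        A ^ ((3 * c + 1) * (4 * c)) * (p : ℝ) ^ (2 * n * (3 * c + 1) * (6 * c)) := by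
      rw [mul_pow, hX, ← pow_mul]; congr 2; ring
    have e2 : (((p ^ (2 * n)) ^ ((3 * c + 1) * (6 * c + 1)) : ℕ) : ℝ) =
        (p : ℝ) ^ (2 * n * (3 * c + 1)) * (p : ℝ) ^ (2 * n * (3 * c + 1) * (6 * c)) := by
      push_cast
      rw [← pow_mul, ← pow_add]; congr 1; ring
    rw [e1, e2, ← mul_assoc, ← mul_assoc, mul_assoc (_ : ℝ) (C ^ (k + 1)) (A ^ _)]
    exact mul_lt_mul_of_pos_right hQn (by positivity)

end

section
open Polynomial

theorem exists_linear_relation {K ι : Type*} [Field K] [Fintype ι] [DecidableEq ι]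
    (S : Set (ι → K))
    (h : ∀ v : ι → ι → K, (∀ r, v r ∈ S) → Matrix.det (Matrix.of fun l r => v r l) = 0) :
    ∃ a : ι → K, a ≠ 0 ∧ ∀ v ∈ S, ∑ l, a l * v l = 0 := by
  by_cases hS : Submodule.span K S = ⊤
  · exfalso
    have hfin : Module.finrank K (Submodule.span K S) = Fintype.card ι := by
      rw [hS, finrank_top, Module.finrank_fintype_fun_eq_card]
    obtain ⟨g, hg, -, hli⟩ := Submodule.exists_fun_fin_finrank_span_eq K S
    let e : ι ≃ Fin (Module.finrank K (Submodule.span K S)) :=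
      (Fintype.equivFin ι).trans (finCongr hfin.symm)
    have hli' : LinearIndependent K (fun i => g (e i)) := hli.comp e e.injective
    have h0 := h (fun i => g (e i)) fun i => hg _
    have hu := (Matrix.isUnit_iff_isUnit_det _).1
      ((Matrix.linearIndependent_rows_iff_isUnit (A := Matrix.of fun i => g (e i))).1 hli')
    have h1 : Matrix.det (Matrix.of fun l r => g (e r) l) =
        Matrix.det (Matrix.of fun i => g (e i)) := by
      rw [← Matrix.det_transpose]; rfl
    rw [h1] at h0
    exact hu.ne_zero h0
  · obtain ⟨φ, hφ, hle⟩ := Submodule.exists_le_ker_of_lt_top _ (lt_top_iff_ne_top.2 hS)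
    refine ⟨fun l => φ (Pi.single l 1), fun h0 => hφ ?_, fun v hv => ?_⟩
    · refine LinearMap.pi_ext' fun l => LinearMap.ext_ring ?_
      simpa using congrFun h0 l
    · have : φ v = 0 := hle (Submodule.subset_span hv)
      rw [← this]
      conv_rhs => rw [← Finset.univ_sum_single v, map_sum]
      refine Finset.sum_congr rfl fun l _ => ?_
      have : (Pi.single l (v l) : ι → K) = v l • Pi.single l 1 := by
        rw [← Pi.single_smul, smul_eq_mul, mul_one]
      rw [this, map_smul, smul_eq_mul, mul_comm]

/-- If `f` has no root in `K(T)`, then the curve `f = 0` meets a curve `A(T) + B(T) Y = 0` in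
boundedly many points. -/
theorem exists_resultant_bound {K : Type*} [Field K] (f : K[X][X]) (hf : f.Monic)
    (hroot : ∀ y : FractionRing K[X], (f.map (algebraMap K[X] (FractionRing K[X]))).eval y ≠ 0)
    (k : ℕ) :
    ∃ M : ℕ, ∀ a : Fin (k + 1) × Fin 2 → K, a ≠ 0 → ∃ R : K[X], R ≠ 0 ∧ R.natDegree ≤ M ∧
      ∀ t x : K, f.evalEval t x = 0 → ∑ l, a l * (t ^ (l.1 : ℕ) * x ^ (l.2 : ℕ)) = 0 →
        R.eval t = 0 := by
  refine ⟨∑ j ∈ Finset.range (f.natDegree + 1), (f.coeff j).natDegree + f.natDegree * k,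
    fun a ha => ?_⟩
  set A : K[X] := ∑ i : Fin (k + 1), monomial (i : ℕ) (a (i, 0)) with hA
  set B : K[X] := ∑ i : Fin (k + 1), monomial (i : ℕ) (a (i, 1)) with hB
  have hAd : A.natDegree ≤ k := natDegree_sum_le_of_forall_le _ _ fun i _ =>
    (natDegree_monomial_le _).trans (Nat.lt_succ_iff.1 i.2)
  have hBd : B.natDegree ≤ k := natDegree_sum_le_of_forall_le _ _ fun i _ =>
    (natDegree_monomial_le _).trans (Nat.lt_succ_iff.1 i.2)
  have hcoeff (b : Fin (k + 1) → K) (i : Fin (k + 1)) :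
      (∑ i : Fin (k + 1), monomial (i : ℕ) (b i)).coeff i = b i := by
    rw [finsetSum_coeff, Finset.sum_eq_single i]
    · simp
    · intro j _ hj
      rw [coeff_monomial, if_neg fun h => hj (Fin.ext h)]
    · simp
  have hAB : A ≠ 0 ∨ B ≠ 0 := by
    by_contra! hc
    refine ha (funext fun l => ?_)
    obtain ⟨i, j⟩ := l
    fin_cases j
    · have := hcoeff (fun i => a (i, 0)) i
      rw [← hA, hc.1] at this
      exact this.symm
    · have := hcoeff (fun i => a (i, 1)) i
      rw [← hB, hc.2] at this
      exact this.symm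
  refine ⟨(f.scaleRoots B).eval (-A), fun h0 => ?_, ?_, fun t x hx hl => ?_⟩
  · by_cases hB0 : B = 0
    · rw [hB0, scaleRoots_zero, hf.leadingCoeff] at h0
      simp at h0
      exact hAB.elim (fun h => h h0.1) (fun h => h hB0)
    · set φ := algebraMap K[X] (FractionRing K[X])
      have hφB : φ B ≠ 0 := fun h => hB0 ((IsFractionRing.injective K[X] (FractionRing K[X]))
        (by rw [h, map_zero]))
      apply hroot (φ (-A) / φ B)
      have h1 := scaleRoots_eval₂_mul (p := f) φ (φ (-A) / φ B) B
      rw [mul_div_cancel₀ _ hφB, eval₂_hom, h0, map_zero] at h1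
      rw [eval_map]
      exact (mul_eq_zero.1 h1.symm).resolve_left (pow_ne_zero _ hφB)
  · rw [eval_eq_sum_range, natDegree_scaleRoots]
    refine natDegree_sum_le_of_forall_le _ _ fun j hj => ?_
    rw [coeff_scaleRoots]
    have hj' := Nat.lt_succ_iff.1 (Finset.mem_range.1 hj)
    refine natDegree_mul_le.trans ((add_le_add natDegree_mul_le le_rfl).trans ?_)
    have h1 : (f.coeff j).natDegree ≤ ∑ j ∈ Finset.range (f.natDegree + 1),
      (f.coeff j).natDegree := Finset.single_le_sum (f := fun j => (f.coeff j).natDegree)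
        (fun _ _ => Nat.zero_le _) hj
    have h2 : (B ^ (f.natDegree - j)).natDegree ≤ (f.natDegree - j) * k :=
      natDegree_pow_le.trans (Nat.mul_le_mul_left _ hBd)
    have h3 : ((-A) ^ j).natDegree ≤ j * k :=
      natDegree_pow_le.trans (Nat.mul_le_mul_left _ (by rwa [natDegree_neg]))
    have h4 : (f.natDegree - j) * k + j * k = f.natDegree * k := by
      rw [← add_mul, Nat.sub_add_cancel hj']
    omega
  · have hl' : A.eval t + B.eval t * x = 0 := by
      rw [← hl, hA, hB, eval_finsetSum, eval_finsetSum, Finset.sum_mul, ← Finset.sum_add_distrib,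
        Fintype.sum_prod_type]
      refine Finset.sum_congr rfl fun i _ => ?_
      simp [mul_assoc]
    have h1 := scaleRoots_eval₂_mul (p := f) (evalRingHom t) x B
    rw [eval₂_evalRingHom, hx, mul_zero] at h1
    have h2 : (evalRingHom t) B * x = (evalRingHom t) (-A) := by
      simp only [coe_evalRingHom, eval_neg]
      linear_combination hl'
    rw [h2, ← eval₂_evalRingHom, eval₂_hom] at h1
    exact h1

end

/-- A notion of smallness for sets of integers which is fulfilled by the exceptional sets in
Hilbert's irreducibility theorem. -/
def IsHilbertThin (Z : Set ℤ) : Prop :=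
  ∀ᶠ t₀ : ℤ in Filter.cofinite, ∃ N : ℕ, N ≠ 0 ∧ ∀ p : ℕ, 2 ≤ p → p.Coprime N →
    ∃ C : ℕ, ∀ n : ℕ, Set.ncard {u : ℕ | u < p ^ (3 * n) ∧ t₀ + p * u ∈ Z} ≤ C * p ^ (2 * n)

section
open Polynomial

/-- Hilbert's irreducibility theorem for roots. -/
theorem isHilbertThin_setOf_root {E : Type*} [Field E] [NumberField E]
    (f : (NumberField.RingOfIntegers E)[X][X]) (hf : f.Monic)
    (hroot : ∀ y : FractionRing E[X], ((f.map (mapRingHom (algebraMap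
      (NumberField.RingOfIntegers E) E))).map (algebraMap E[X] (FractionRing E[X]))).eval y ≠ 0)
    (hsep : ∃ (u v : (NumberField.RingOfIntegers E)[X][X]) (δ : (NumberField.RingOfIntegers E)[X]),
      δ ≠ 0 ∧ u * f + v * derivative f = C δ) :
    IsHilbertThin {t | ∃ x : NumberField.RingOfIntegers E,
      f.evalEval (t : NumberField.RingOfIntegers E) x = 0} := by
  obtain ⟨U, V, δ, hδ, hUV⟩ := hsep
  have hfin : {t₀ : ℤ | δ.eval (t₀ : NumberField.RingOfIntegers E) = 0}.Finite := by
    refine Set.Finite.subset (Set.Finite.preimage (f := fun t : ℤ =>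
      (t : NumberField.RingOfIntegers E)) (Int.cast_injective.injOn) (finite_setOfPred_isRoot hδ)) ?_
    intro t ht
    exact ht
  refine Filter.mem_of_superset hfin.compl_mem_cofinite fun t₀ ht₀ => ?_
  set d := δ.eval (t₀ : NumberField.RingOfIntegers E) with hd
  have hd0 : d ≠ 0 := ht₀
  refine ⟨Ideal.absNorm (Ideal.span {d}), fun h => hd0 ?_, fun p hp hpN => ?_⟩
  · simpa using Ideal.absNorm_eq_zero_iff.1 h
  obtain ⟨k, n₀, hdet⟩ := exists_det_monomials_eq_zero f hf t₀ p hp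
  obtain ⟨M, hM⟩ := exists_resultant_bound _ (hf.map (mapRingHom (algebraMap
      (NumberField.RingOfIntegers E) E))) hroot k
  have hinv (u : ℕ) (x : NumberField.RingOfIntegers E)
      (hx : f.evalEval ((t₀ + p * u : ℤ) : NumberField.RingOfIntegers E) x = 0) :
      ∃ a, (p : NumberField.RingOfIntegers E) ∣ 1 - a * (derivative f).evalEval
        ((t₀ + p * u : ℤ) : NumberField.RingOfIntegers E) x := by
    have h1 := congrArg (evalEval ((t₀ + p * u : ℤ) : NumberField.RingOfIntegers E) x) hUV
    rw [evalEval_add, evalEval_mul, evalEval_mul, hx, mul_zero, zero_add, evalEval_C] at h1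
    obtain ⟨e, he⟩ : (p : NumberField.RingOfIntegers E) ∣
        δ.eval ((t₀ + p * u : ℤ) : NumberField.RingOfIntegers E) - d :=
      (Dvd.intro (u : NumberField.RingOfIntegers E) (by push_cast; ring)).trans
        (sub_dvd_eval_sub _ _ δ)
    obtain ⟨w, hw⟩ := Ideal.mem_span_singleton.1 (Ideal.absNorm_mem (Ideal.span {d}))
    have hcop : IsCoprime (p : NumberField.RingOfIntegers E)
        (Ideal.absNorm (Ideal.span {d}) : NumberField.RingOfIntegers E) := by
      simpa using (Nat.isCoprime_iff_coprime.2 hpN).map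
        (Int.castRingHom (NumberField.RingOfIntegers E))
    obtain ⟨β, α, hαβ⟩ := hcop
    rw [hw] at hαβ
    refine ⟨α * w * V.evalEval ((t₀ + p * u : ℤ) : NumberField.RingOfIntegers E) x,
      β - α * w * e, ?_⟩
    linear_combination -hαβ - α * w * h1 - α * w * he
  have hpR : Ideal.span {(p : NumberField.RingOfIntegers E)} ≠ ⊥ := by
    rw [Ne, Ideal.span_singleton_eq_bot]
    exact_mod_cast (by omega : p ≠ 0)
  have : Finite (NumberField.RingOfIntegers E ⧸
      Ideal.span {(p : NumberField.RingOfIntegers E)}) := Ideal.finiteQuotientOfFreeOfNeBot _ hpR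
  have := Fintype.ofFinite (NumberField.RingOfIntegers E ⧸
      Ideal.span {(p : NumberField.RingOfIntegers E)})
  set G := Fintype.card (NumberField.RingOfIntegers E ⧸
      Ideal.span {(p : NumberField.RingOfIntegers E)})
  refine ⟨M * G + p ^ (3 * n₀), fun n => ?_⟩
  set S : Set ℕ := {u : ℕ | u < p ^ (3 * n) ∧ t₀ + p * u ∈ {t : ℤ | ∃ x :
    NumberField.RingOfIntegers E, f.evalEval (t : NumberField.RingOfIntegers E) x = 0}} with hS
  have hSsub : S ⊆ Finset.range (p ^ (3 * n)) := fun u hu => by simpa using hu.1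
  have hSfin : S.Finite := (Finset.finite_toSet _).subset hSsub
  have hpp : 1 ≤ p ^ (2 * n) := Nat.one_le_pow _ _ (by omega)
  rcases lt_or_ge n n₀ with hn | hn
  · calc S.ncard ≤ p ^ (3 * n) := by
          simpa using Set.ncard_le_ncard hSsub (Finset.finite_toSet _)
      _ ≤ p ^ (3 * n₀) := Nat.pow_le_pow_right (by omega) (by omega)
      _ ≤ (M * G + p ^ (3 * n₀)) * p ^ (2 * n) := 
          (Nat.le_add_left _ _).trans (Nat.le_mul_of_pos_right _ hpp)
  classical
  have hx : ∀ u : ℕ, ∃ x : NumberField.RingOfIntegers E, u ∈ S →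
      f.evalEval ((t₀ + p * u : ℤ) : NumberField.RingOfIntegers E) x = 0 := fun u => by
    by_cases hu : u ∈ S
    · obtain ⟨x, hx⟩ := hu.2
      exact ⟨x, fun _ => hx⟩
    · exact ⟨0, fun h => absurd h hu⟩
  choose x hx using hx
  rw [Set.ncard_eq_toFinset_card S hSfin]
  have hcard := Finset.card_le_mul_card_image_of_maps_to (s := hSfin.toFinset)
    (t := Finset.range (p ^ (2 * n)) ×ˢ (Finset.univ : Finset (NumberField.RingOfIntegers E ⧸
      Ideal.span {(p : NumberField.RingOfIntegers E)})))
    (f := fun u => (u % p ^ (2 * n), Ideal.Quotient.mk _ (x u)))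
    (fun u _ => by simpa using Nat.mod_lt _ (by omega)) M (fun b _ => ?_)
  · rw [Finset.card_product, Finset.card_range, Finset.card_univ] at hcard
    exact hcard.trans (by
      have : M * (p ^ (2 * n) * G) = M * G * p ^ (2 * n) := by ring
      change M * (p ^ (2 * n) * G) ≤ _
      rw [this]; gcongr; omega)
  · set F := hSfin.toFinset.filter fun u =>
      (u % p ^ (2 * n), Ideal.Quotient.mk (Ideal.span {(p : NumberField.RingOfIntegers E)}) (x u)) = b
    rcases F.eq_empty_or_nonempty with hF | ⟨u₁, hu₁⟩
    · rw [hF]; simp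
    have hFm : ∀ u ∈ F, u ∈ S ∧ u ≡ u₁ [MOD p ^ (2 * n)] ∧
        (p : NumberField.RingOfIntegers E) ∣ x u₁ - x u := fun u hu => by
      have h1 := Finset.mem_filter.1 hu
      have h2 := Finset.mem_filter.1 hu₁
      have h3 := h1.2.trans h2.2.symm
      rw [Prod.mk.injEq] at h3
      exact ⟨by simpa using h1.1, h3.1, by
        rw [← Ideal.mem_span_singleton, ← Ideal.Quotient.eq]; exact h3.2.symm⟩
    obtain ⟨a, ha⟩ := hinv u₁ (x u₁) (hx u₁ (hFm u₁ hu₁).1)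
    let vec : ℕ → Fin (k + 1) × Fin 2 → E := fun u l =>
      ((t₀ + p * u : ℤ) : E) ^ (l.1 : ℕ) * (x u : E) ^ (l.2 : ℕ)
    obtain ⟨b, hb0, hb⟩ := exists_linear_relation (vec '' F) fun v hv => by
      choose u hu huv using hv
      have h1 := hdet n hn u₁ (x u₁) a ha u (fun r => x (u r)) (fun r => (hFm _ (hu r)).1.1)
        (fun r => (hFm _ (hu r)).2.1) (fun r => hx _ (hFm _ (hu r)).1)
        (fun r => (hFm _ (hu r)).2.2)
      have h2 := congrArg (algebraMap (NumberField.RingOfIntegers E) E) h1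
      rw [RingHom.map_det, map_zero] at h2
      rw [← h2]
      congr 1
      ext l r
      simp only [Matrix.of_apply, RingHom.mapMatrix_apply, Matrix.map_apply, map_mul, map_pow,
        map_intCast, ← huv, vec]
    obtain ⟨R, hR0, hRd, hR⟩ := hM b hb0
    have hmaps : Set.MapsTo (fun u : ℕ => ((t₀ + p * u : ℤ) : E)) F R.roots.toFinset := by
      intro u hu
      simp only [Finset.mem_coe, Multiset.mem_toFinset, mem_roots hR0]
      refine hR _ (x u : E) ?_ (hb _ ⟨u, hu, rfl⟩)
      have := map_mapRingHom_evalEval (algebraMap (NumberField.RingOfIntegers E) E)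
        ((t₀ + p * u : ℤ) : NumberField.RingOfIntegers E) (x u) (p := f)
      rw [hx u (hFm u hu).1, map_zero, map_intCast] at this
      exact this
    have hinj : Set.InjOn (fun u : ℕ => ((t₀ + p * u : ℤ) : E)) F := by
      intro u _ v _ huv
      have h1 : (t₀ + p * u : ℤ) = t₀ + p * v := Int.cast_injective (α := E) huv
      have h2 : p ≠ 0 := by omega
      simpa [h2] using h1
    exact (Finset.card_le_card_of_injOn _ hmaps hinj).trans
      ((Multiset.toFinset_card_le _).trans ((card_roots' R).trans hRd))

end

theorem IsHilbertThin.mono {Z Z' : Set ℤ} (h : IsHilbertThin Z') (hZ : Z ⊆ Z') :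
    IsHilbertThin Z := by
  filter_upwards [h] with t₀ ⟨N, hN, h⟩
  refine ⟨N, hN, fun p hp hpN => ?_⟩
  obtain ⟨C, hC⟩ := h p hp hpN
  refine ⟨C, fun n => le_trans (Set.ncard_le_ncard ?_ ?_) (hC n)⟩
  · exact fun u hu => ⟨hu.1, hZ hu.2⟩
  exact (Set.finite_lt_nat (p ^ (3 * n))).subset fun u hu => hu.1

theorem IsHilbertThin.union {Z Z' : Set ℤ} (h : IsHilbertThin Z) (h' : IsHilbertThin Z') :
    IsHilbertThin (Z ∪ Z') := by
  filter_upwards [h, h'] with t₀ ⟨N, hN, h⟩ ⟨N', hN', h'⟩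
  refine ⟨N * N', mul_ne_zero hN hN', fun p hp hpN => ?_⟩
  obtain ⟨C, hC⟩ := h p hp (hpN.coprime_mul_right_right)
  obtain ⟨C', hC'⟩ := h' p hp (hpN.coprime_mul_left_right)
  refine ⟨C + C', fun n => ?_⟩
  rw [add_mul]
  refine le_trans ?_ (add_le_add (hC n) (hC' n))
  refine le_trans (le_of_eq ?_) (Set.ncard_union_le _ _)
  congr 1
  ext u
  simp only [Set.mem_union, Set.mem_ofPred_eq]
  tauto

theorem isHilbertThin_of_finite {Z : Set ℤ} (h : Z.Finite) : IsHilbertThin Z := by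
  refine Filter.Eventually.of_forall fun t₀ => ⟨1, one_ne_zero, fun p hp _ => ⟨Z.ncard, fun n => ?_⟩⟩
  have hp0 : (p : ℤ) ≠ 0 := by omega
  refine le_trans ?_ (Nat.le_mul_of_pos_right _ (Nat.pow_pos (by omega)))
  refine Set.ncard_le_ncard_of_injOn (fun u : ℕ => t₀ + p * (u : ℤ)) (fun u hu => hu.2) ?_ h
  intro u _ v _ huv
  have h1 : t₀ + p * (u : ℤ) = t₀ + p * v := huv
  have h2 := mul_left_cancel₀ hp0 (add_left_cancel h1)
  exact_mod_cast h2

theorem not_isHilbertThin_univ : ¬ IsHilbertThin Set.univ := by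
  intro h
  obtain ⟨t₀, N, hN, h⟩ := h.exists
  obtain ⟨p, hpN, hp⟩ := Nat.exists_infinite_primes (N + 1)
  obtain ⟨C, hC⟩ := h p hp.two_le ((Nat.Prime.coprime_iff_not_dvd hp).2 fun hd =>
    absurd (Nat.le_of_dvd (Nat.pos_of_ne_zero hN) hd) (by omega))
  have h1 := hC (C + 1)
  have h2 : {u : ℕ | u < p ^ (3 * (C + 1)) ∧ t₀ + p * (u : ℤ) ∈ Set.univ} =
      (Finset.range (p ^ (3 * (C + 1))) : Set ℕ) := by ext; simp
  rw [h2, Set.ncard_coe_finset, Finset.card_range] at h1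
  have h3 : p ^ (3 * (C + 1)) = p ^ (C + 1) * p ^ (2 * (C + 1)) := by rw [← pow_add]; congr 1; ring
  rw [h3] at h1
  have h4 := Nat.le_of_mul_le_mul_right h1 (Nat.pow_pos hp.pos)
  have h5 := Nat.lt_pow_self hp.one_lt (n := C + 1)
  omega

/-- The filter of complements of thin sets. -/
def hilbertFilter : Filter ℤ where
  sets := {Z | IsHilbertThin Zᶜ}
  univ_sets := by
    simpa using isHilbertThin_of_finite Set.finite_empty
  sets_of_superset := fun h hs => IsHilbertThin.mono h (Set.compl_subset_compl.2 hs)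
  inter_sets := fun h h' => by
    simpa [Set.compl_inter] using IsHilbertThin.union h h'

instance hilbertFilter_neBot : hilbertFilter.NeBot := by
  refine ⟨fun h => not_isHilbertThin_univ ?_⟩
  have : (∅ : Set ℤ) ∈ hilbertFilter := by rw [h]; trivial
  have h' : IsHilbertThin (∅ : Set ℤ)ᶜ := this
  rwa [Set.compl_empty] at h'

theorem hilbertFilter_le_cofinite : hilbertFilter ≤ Filter.cofinite :=
  fun _ hZ => isHilbertThin_of_finite (Filter.mem_cofinite.1 hZ)

/-- An ultrafilter of integers at which Hilbert's irreducibility theorem holds. -/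
def hilbertUltrafilter : Ultrafilter ℤ := Ultrafilter.of hilbertFilter

theorem hilbertUltrafilter_le : (hilbertUltrafilter : Filter ℤ) ≤ hilbertFilter :=
  Ultrafilter.of_le _

section
open Polynomial

/-- The simple extension `k(s)` as a subfield. -/
def adj {L : Type*} [Field L] (k : Subfield L) (s : L) : Subfield L :=
  (IntermediateField.adjoin k {s}).toSubfield

theorem mem_adj {L : Type*} [Field L] {k : Subfield L} {s x : L} :
    x ∈ adj k s ↔ x ∈ IntermediateField.adjoin k {s} := Iff.rfl

theorem le_adj {L : Type*} [Field L] (k : Subfield L) (s : L) : k ≤ adj k s := fun x hx =>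
  (IntermediateField.adjoin k {s}).algebraMap_mem ⟨x, hx⟩

theorem self_mem_adj {L : Type*} [Field L] (k : Subfield L) (s : L) : s ∈ adj k s :=
  IntermediateField.mem_adjoin_simple_self k s

theorem adj_le {L : Type*} [Field L] {k M : Subfield L} {s : L} (h : k ≤ M) (hs : s ∈ M) :
    adj k s ≤ M := by
  rw [adj, IntermediateField.adjoin_toSubfield, Subfield.closure_le]
  rintro x (⟨y, rfl⟩ | rfl)
  · exact h y.2
  · exact hs

theorem adj_mono {L : Type*} [Field L] {k k' : Subfield L} (h : k ≤ k') (s : L) :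
    adj k s ≤ adj k' s := adj_le (h.trans (le_adj _ _)) (self_mem_adj _ _)

theorem adj_comap_le {L M : Type*} [Field L] [Field M] (j : L →+* M) (F : Subfield M) (s : L) :
    adj (F.comap j) s ≤ (adj F (j s)).comap j :=
  adj_le (fun _ hx => le_adj _ _ hx) (self_mem_adj F (j s))

theorem mem_range_of_isIntegralElem {D M : Type*} [Field D] [IsAlgClosed D] [CommRing M]
    [IsDomain M] (j : D →+* M) {x : M} (hx : j.IsIntegralElem x) : ∃ d, j d = x := by
  let := j.toAlgebra
  have h : IsIntegral D x := hx
  exact minpoly.mem_range_of_degree_eq_one D x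
    (IsAlgClosed.degree_eq_one_of_irreducible D (minpoly.irreducible h))

/-- Linear disjointness of an algebraically closed field and a subfield over their
intersection, for minimal polynomials. -/
theorem natDegree_minpoly_comap {D M : Type*} [Field D] [IsAlgClosed D] [Field M] (j : D →+* M)
    (F : Subfield M) (w : D) (hw : IsAlgebraic (F.comap j) w) :
    IsAlgebraic F (j w) ∧
      (minpoly F (j w)).natDegree = (minpoly (F.comap j) w).natDegree := by
  have hwi : IsIntegral (F.comap j) w := hw.isIntegral
  let jk : F.comap j →+* F := (j.comp (F.comap j).subtype).codRestrict F fun x => x.2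
  have hjk : F.subtype.comp jk = j.comp (F.comap j).subtype := rfl
  have heval (q : (F.comap j)[X]) : aeval (j w) (q.map jk) = j (aeval w q) := by
    rw [aeval_def, aeval_def, eval₂_map, hom_eval₂]
    rfl
  have hroot : aeval (j w) ((minpoly (F.comap j) w).map jk) = 0 := by
    rw [heval, minpoly.aeval, map_zero]
  have hintegral : IsIntegral F (j w) := ⟨_, (minpoly.monic hwi).map jk, hroot⟩
  refine ⟨hintegral.isAlgebraic, le_antisymm ?_ ?_⟩
  · rw [← (minpoly.monic hwi).natDegree_map jk]
    exact natDegree_le_of_dvd (minpoly.dvd _ _ hroot) ((minpoly.monic hwi).map jk).ne_zero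
  · have hdvd : (minpoly F (j w)).map F.subtype ∣
        ((minpoly (F.comap j) w).map (F.comap j).subtype).map j := by
      rw [Polynomial.map_map, ← hjk, ← Polynomial.map_map]
      exact Polynomial.map_dvd _ (minpoly.dvd _ _ hroot)
    have hcoef (i : ℕ) : ∃ d, j d = ((minpoly F (j w)).map F.subtype).coeff i := by
      let := j.toAlgebra
      exact mem_range_of_isIntegralElem j (isIntegral_coeff_of_dvd _ _
        ((minpoly.monic hwi).map _) ((minpoly.monic hintegral).map _) hdvd i)
    have hlift : minpoly F (j w) ∈ lifts jk := by
      rw [lifts_iff_coeff_lifts]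
      intro i
      obtain ⟨d, hd⟩ := hcoef i
      rw [coeff_map] at hd
      refine ⟨⟨d, ?_⟩, Subtype.ext hd⟩
      rw [Subfield.mem_comap, hd]
      exact ((minpoly F (j w)).coeff i).2
    obtain ⟨q, hq, hqd, hqm⟩ := lifts_and_natDegree_eq_and_monic hlift (minpoly.monic hintegral)
    rw [← hqd]
    refine natDegree_le_of_dvd (minpoly.dvd _ _ ?_) hqm.ne_zero
    apply j.injective
    rw [← heval, hq, minpoly.aeval, map_zero]

theorem exists_primitive {L : Type*} [Field L] [CharZero L] (k : Subfield L) (S : Finset L)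
    (h : ∀ x ∈ S, IsAlgebraic k x) :
    ∃ w, IsAlgebraic k w ∧ IntermediateField.adjoin k {w} = IntermediateField.adjoin k (S : Set L) := by
  have hfd : FiniteDimensional k (IntermediateField.adjoin k (S : Set L)) :=
    IntermediateField.finiteDimensional_adjoin fun x hx => (h x hx).isIntegral
  have : CharZero k := (RingHom.charZero_iff k.subtype.injective).2 inferInstance
  obtain ⟨α, hα⟩ := Field.exists_primitive_element k (IntermediateField.adjoin k (S : Set L))
  refine ⟨α, ?_, ?_⟩
  · exact (Algebra.IsAlgebraic.isAlgebraic (R := k) α).algHom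
      (IntermediateField.adjoin k (S : Set L)).val
  · have := congrArg (IntermediateField.map (IntermediateField.adjoin k (S : Set L)).val) hα
    rw [IntermediateField.adjoin_map, ← AlgHom.fieldRange_eq_map,
      IntermediateField.fieldRange_val] at this
    simpa using this

/-- Linear disjointness of an algebraically closed field and a subfield over their
intersection, for simple extensions. -/
theorem mem_adj_of_map_mem_adj {D M : Type*} [Field D] [CharZero D] [IsAlgClosed D] [Field M]
    (j : D →+* M) (F : Subfield M) (s x : D) (hs : IsAlgebraic (F.comap j) s)
    (hx : IsAlgebraic (F.comap j) x) (h : j x ∈ adj F (j s)) : x ∈ adj (F.comap j) s := by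
  classical
  obtain ⟨w, hw, hadj⟩ := exists_primitive (F.comap j) {s, x} (by simp [hs, hx])
  have hsub : ({s, x} : Finset D) ≤ (IntermediateField.adjoin (F.comap j) {w} : Set D) := by
    rw [hadj]; exact IntermediateField.subset_adjoin _ _
  have hsw : s ∈ IntermediateField.adjoin (F.comap j) {w} := hsub (by simp)
  have hxw : x ∈ IntermediateField.adjoin (F.comap j) {w} := hsub (by simp)
  have hjw : j w ∈ IntermediateField.adjoin F {j s} := by
    have h1 : (IntermediateField.adjoin (F.comap j) {w}).toSubfield ≤ (adj F (j s)).comap j := by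
      rw [hadj, IntermediateField.adjoin_toSubfield, Subfield.closure_le]
      rintro y (⟨y, rfl⟩ | hy)
      · exact le_adj _ _ y.2
      · simp only [Finset.coe_insert, Finset.coe_singleton, Set.mem_insert_iff,
          Set.mem_singleton_iff] at hy
        rcases hy with rfl | rfl
        · exact self_mem_adj _ _
        · exact h
    exact h1 (IntermediateField.mem_adjoin_simple_self (F.comap j) w)
  obtain ⟨hs', hsd⟩ := natDegree_minpoly_comap j F s hs
  obtain ⟨hw', hwd⟩ := natDegree_minpoly_comap j F w hw
  have hle : IntermediateField.adjoin (F.comap j) {s} ≤ IntermediateField.adjoin (F.comap j) {w} :=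
    IntermediateField.adjoin_simple_le_iff.2 hsw
  have : FiniteDimensional (F.comap j) (IntermediateField.adjoin (F.comap j) {w}) :=
    IntermediateField.adjoin.finiteDimensional hw.isIntegral
  have : FiniteDimensional F (IntermediateField.adjoin F {j s}) :=
    IntermediateField.adjoin.finiteDimensional hs'.isIntegral
  have heq := IntermediateField.eq_of_le_of_finrank_le hle (by
    rw [IntermediateField.adjoin.finrank hs.isIntegral, IntermediateField.adjoin.finrank hw.isIntegral,
      ← hsd, ← hwd, ← IntermediateField.adjoin.finrank hs'.isIntegral,
      ← IntermediateField.adjoin.finrank hw'.isIntegral]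
    exact IntermediateField.finrank_le_of_le_right (IntermediateField.adjoin_simple_le_iff.2 hjw))
  rw [mem_adj, heq]
  exact hxw

end

/-- The ultrapower of `K`. -/
abbrev UPow {ι : Type*} (U : Ultrafilter ι) (K : Type*) := Filter.Germ (U : Filter ι) K

section
open Polynomial

variable {ι K : Type*} [Field K] (U : Ultrafilter ι)

/-- The class of a function in the ultrapower. -/
def mkG : (ι → K) →+* UPow U K := Filter.Germ.coeRingHom (U : Filter ι)

theorem mkG_eq {f g : ι → K} : mkG U f = mkG U g ↔ ∀ᶠ i in (U : Filter ι), f i = g i :=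
  Filter.Germ.coe_eq

theorem exists_mkG (x : UPow U K) : ∃ f : ι → K, mkG U f = x := Quot.exists_rep x

/-- The diagonal embedding into the ultrapower. -/
def constG : K →+* UPow U K := (mkG U).comp (Pi.constRingHom ι K)

theorem constG_eq (a : K) : constG U a = mkG U (fun _ => a) := rfl

instance [CharZero K] : CharZero (UPow U K) :=
  (RingHom.charZero_iff (constG U (K := K)).injective).1 inferInstance

/-- The internal subfield of the ultrapower given by a family of subfields. -/
def internal (F : ι → Subfield K) : Subfield (UPow U K) where
  carrier := {x | ∃ f : ι → K, (∀ i, f i ∈ F i) ∧ mkG U f = x}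
  mul_mem' := by
    rintro _ _ ⟨f, hf, rfl⟩ ⟨g, hg, rfl⟩
    exact ⟨f * g, fun i => mul_mem (hf i) (hg i), map_mul _ _ _⟩
  one_mem' := ⟨1, fun i => one_mem _, map_one _⟩
  add_mem' := by
    rintro _ _ ⟨f, hf, rfl⟩ ⟨g, hg, rfl⟩
    exact ⟨f + g, fun i => add_mem (hf i) (hg i), map_add _ _ _⟩
  zero_mem' := ⟨0, fun i => zero_mem _, map_zero _⟩
  neg_mem' := by
    rintro _ ⟨f, hf, rfl⟩
    exact ⟨-f, fun i => neg_mem (hf i), map_neg _ _⟩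
  inv_mem' := by
    rintro _ ⟨f, hf, rfl⟩
    exact ⟨f⁻¹, fun i => inv_mem (hf i), rfl⟩

variable {U}

theorem mkG_mem_internal {F : ι → Subfield K} {f : ι → K} :
    mkG U f ∈ internal U F ↔ ∀ᶠ i in (U : Filter ι), f i ∈ F i := by
  classical
  constructor
  · rintro ⟨g, hg, h⟩
    filter_upwards [(mkG_eq U).1 h] with i hi
    rw [← hi]; exact hg i
  · intro h
    refine ⟨fun i => if f i ∈ F i then f i else 0, fun i => ?_, (mkG_eq U).2 ?_⟩
    · change (if f i ∈ F i then f i else 0) ∈ F i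
      split_ifs with hi
      exacts [hi, zero_mem _]
    · filter_upwards [h] with i hi
      rw [if_pos hi]

theorem internal_mono {F F' : ι → Subfield K} (h : ∀ i, F i ≤ F' i) :
    internal U F ≤ internal U F' := fun _ ⟨f, hf, h'⟩ => ⟨f, fun i => h i (hf i), h'⟩

theorem exists_monic_rep {F : ι → Subfield K} (p : (internal U F)[X]) (hp : p.Monic) :
    ∃ P : ∀ i, (F i)[X], (∀ i, (P i).Monic ∧ (P i).natDegree = p.natDegree) ∧
      ∀ s : ι → K, aeval (mkG U s) p = mkG U (fun i => aeval (s i) (P i)) := by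
  have h (n : ℕ) : ∃ r : ∀ i, F i, mkG U (fun i => (r i : K)) = (p.coeff n : UPow U K) := by
    obtain ⟨f, hf, h⟩ := (p.coeff n).2
    exact ⟨fun i => ⟨f i, hf i⟩, h⟩
  choose r hr using h
  have hdeg (i : ι) : (∑ l ∈ Finset.range p.natDegree, monomial l (r l i)).degree < p.natDegree := by
    refine (degree_sum_le _ _).trans_lt ((Finset.sup_lt_iff (WithBot.bot_lt_coe _)).2 fun l hl => ?_)
    exact (degree_monomial_le _ _).trans_lt (by exact_mod_cast Finset.mem_range.1 hl)
  refine ⟨fun i => X ^ p.natDegree + ∑ l ∈ Finset.range p.natDegree, monomial l (r l i),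
    fun i => ⟨monic_X_pow_add (hdeg i), natDegree_eq_of_degree_eq_some
      ((degree_add_eq_left_of_degree_lt (by rw [degree_X_pow]; exact hdeg i)).trans
        (degree_X_pow _))⟩, fun s => ?_⟩
  have hfun : (fun i => aeval (s i) (X ^ p.natDegree +
      ∑ l ∈ Finset.range p.natDegree, monomial l (r l i))) =
      s ^ p.natDegree + ∑ l ∈ Finset.range p.natDegree, (fun i => (r l i : K)) * s ^ l := by
    ext i
    simp only [map_add, map_pow, aeval_X, map_sum, aeval_monomial, Pi.add_apply, Pi.pow_apply,
      Finset.sum_apply, Pi.mul_apply]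
    rfl
  rw [hfun, map_add, map_pow, map_sum, aeval_eq_sum_range, Finset.sum_range_succ, add_comm]
  congr 1
  · rw [show p.coeff p.natDegree = 1 from hp, one_smul]
  · refine Finset.sum_congr rfl fun l _ => ?_
    rw [map_mul, hr, map_pow]
    rfl

instance [IsAlgClosed K] : IsAlgClosed (UPow U K) := by
  refine IsAlgClosed.of_exists_root _ fun p hp hirr => ?_
  have htop (x : UPow U K) : x ∈ internal U (fun _ => (⊤ : Subfield K)) := by
    obtain ⟨f, rfl⟩ := exists_mkG U x
    exact ⟨f, fun i => trivial, rfl⟩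
  let φ : UPow U K →+* internal U (fun _ => (⊤ : Subfield K)) :=
    (RingHom.id _).codRestrict _ htop
  obtain ⟨P, hP, hev⟩ := exists_monic_rep (p.map φ) (hp.map φ)
  have hroot (i : ι) : ∃ x : K, aeval x (P i) = 0 := by
    have hd : (P i).degree ≠ 0 := by
      intro h
      have h1 := natDegree_eq_of_degree_eq_some h
      rw [(hP i).2, hp.natDegree_map] at h1
      exact hirr.natDegree_pos.ne' h1
    exact IsAlgClosed.exists_aeval_eq_zero K (P i) hd
  choose s hs using hroot
  refine ⟨mkG U s, ?_⟩
  have h1 := hev s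
  rw [aeval_def, eval₂_map] at h1
  have h2 : (algebraMap (internal U fun _ => (⊤ : Subfield K)) (UPow U K)).comp φ =
      RingHom.id _ := rfl
  rw [h2, eval₂_id] at h1
  rw [h1, show (fun i => aeval (s i) (P i)) = 0 from funext hs, map_zero]

theorem eq_sum_of_mem_adj {L : Type*} [Field L] {k : Subfield L} {s y : L} (P : k[X])
    (hP : P.Monic) (hs : aeval s P = 0) (hy : y ∈ adj k s) :
    ∃ a : ℕ → k, y = ∑ l ∈ Finset.range P.natDegree, (a l : L) * s ^ l := by
  rw [mem_adj, ← IntermediateField.mem_toSubalgebra,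
    IntermediateField.adjoin_simple_toSubalgebra_of_isAlgebraic ⟨P, hP.ne_zero, hs⟩,
    Algebra.adjoin_singleton_eq_range_aeval] at hy
  obtain ⟨q, rfl⟩ := hy
  refine ⟨fun l => (q %ₘ P).coeff l, ?_⟩
  have h1 : aeval s q = aeval s (q %ₘ P) := by
    conv_lhs => rw [← modByMonic_add_div q P]
    rw [map_add, map_mul, hs, zero_mul, add_zero]
  by_cases hP1 : P = 1
  · simp [hP1] at hs
  · change aeval s q = _
    rw [h1, aeval_eq_sum_range' (natDegree_modByMonic_lt q hP hP1)]
    rfl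

/-- Elements of simple algebraic extensions of internal fields can be computed componentwise. -/
theorem mkG_mem_adj_internal {F : ι → Subfield K} {s y : ι → K}
    (hs : IsAlgebraic (internal U F) (mkG U s)) :
    mkG U y ∈ adj (internal U F) (mkG U s) ↔ ∀ᶠ i in (U : Filter ι), y i ∈ adj (F i) (s i) := by
  constructor
  · intro h
    have hle : adj (internal U F) (mkG U s) ≤ internal U (fun i => adj (F i) (s i)) :=
      adj_le (internal_mono fun i => le_adj _ _)
        (mkG_mem_internal.2 (Filter.Eventually.of_forall fun i => self_mem_adj _ _))
    exact mkG_mem_internal.1 (hle h)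
  · intro h
    have hsi := hs.isIntegral
    obtain ⟨P, hP, hev⟩ := exists_monic_rep _ (minpoly.monic hsi)
    have h0 := hev s
    rw [minpoly.aeval, ← map_zero (mkG U), mkG_eq] at h0
    have hex (i : ι) : ∃ a : ℕ → F i, aeval (s i) (P i) = 0 → y i ∈ adj (F i) (s i) →
        y i = ∑ l ∈ Finset.range (minpoly (internal U F) (mkG U s)).natDegree,
          (a l : K) * s i ^ l := by
      by_cases h : aeval (s i) (P i) = 0 ∧ y i ∈ adj (F i) (s i)
      · obtain ⟨a, ha⟩ := eq_sum_of_mem_adj (P i) (hP i).1 h.1 h.2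
        rw [(hP i).2] at ha
        exact ⟨a, fun _ _ => ha⟩
      · exact ⟨0, fun h1 h2 => absurd ⟨h1, h2⟩ h⟩
    choose a ha using hex
    have hy : mkG U y = ∑ l ∈ Finset.range (minpoly (internal U F) (mkG U s)).natDegree,
        mkG U (fun i => (a i l : K)) * mkG U s ^ l := by
      simp_rw [← map_pow, ← map_mul, ← map_sum]
      rw [mkG_eq]
      filter_upwards [h0, h] with i hi hi'
      rw [ha i hi.symm hi', Finset.sum_apply]
      rfl
    rw [hy]
    exact sum_mem fun l _ => mul_mem (le_adj _ _ ⟨_, fun i => (a i l).2, rfl⟩)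
      (pow_mem (self_mem_adj _ _) _)

/-- Membership in simple extensions, for a field embedded in an ultrapower. -/
theorem mem_adj_iff_eventually {D : Type*} [Field D] [CharZero D] [IsAlgClosed D]
    (j : D →+* UPow U K) (k₀ : Subfield K)
    (hD : ∀ d : D, IsAlgebraic ((internal U fun _ => k₀).comap j) d) (s x : D) (s' x' : ι → K)
    (hs : mkG U s' = j s) (hx : mkG U x' = j x) :
    (∀ᶠ i in (U : Filter ι), x' i ∈ adj k₀ (s' i)) ↔
      x ∈ adj ((internal U fun _ => k₀).comap j) s := by
  rw [← mkG_mem_adj_internal (F := fun _ => k₀), hs, hx]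
  · exact ⟨mem_adj_of_map_mem_adj j _ s x (hD s) (hD x), fun h => adj_comap_le j _ s h⟩
  · rw [hs]; exact (natDegree_minpoly_comap j _ s (hD s)).1

end

section
open Polynomial

/-- The algebraic closure of the rational function field `D(T)`. -/
abbrev Wf (D : Type*) [Field D] := AlgebraicClosure (FractionRing D[X])

variable {D : Type*} [Field D]

/-- The embedding of constants in `Wf D`. -/
def cst (D : Type*) [Field D] : D →+* Wf D := (algebraMap D[X] (Wf D)).comp C

/-- The variable `T` in `Wf D`. -/
def tt (D : Type*) [Field D] : Wf D := algebraMap D[X] (Wf D) X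

instance [CharZero D] : CharZero (Wf D) := (RingHom.charZero_iff (cst D).injective).1 inferInstance

theorem algebraMap_Wf_injective : Function.Injective (algebraMap D[X] (Wf D)) := by
  rw [IsScalarTower.algebraMap_eq D[X] (FractionRing D[X]) (Wf D)]
  exact (algebraMap (FractionRing D[X]) (Wf D)).injective.comp (IsFractionRing.injective _ _)

theorem eval₂_cst_tt (p : D[X]) : p.eval₂ (cst D) (tt D) = algebraMap D[X] (Wf D) p := by
  rw [cst, tt, ← hom_eval₂, eval₂_C_X]

instance : Module.IsTorsionFree D[X] (Wf D) := by
  have : FaithfulSMul D[X] (Wf D) :=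
    (faithfulSMul_iff_algebraMap_injective _ _).2 algebraMap_Wf_injective
  exact FaithfulSMul.to_isTorsionFree D[X] (Wf D)

instance : Algebra.IsAlgebraic D[X] (Wf D) :=
  (IsFractionRing.comap_isAlgebraic_iff (A := D[X]) (K := FractionRing D[X]) (C := Wf D)).2
    inferInstance

theorem exists_lift {M : Type*} [Field M] [IsAlgClosed M] (e : D →+* M) (m : M)
    (hm : ∀ p : D[X], p.eval₂ e m = 0 → p = 0) :
    ∃ e' : Wf D →+* M, e'.comp (cst D) = e ∧ e' (tt D) = m := by
  let := (eval₂RingHom e m).toAlgebra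
  have hinj : Function.Injective (algebraMap D[X] M) :=
    (injective_iff_map_eq_zero _).2 fun p hp => hm p hp
  have : FaithfulSMul D[X] M := (faithfulSMul_iff_algebraMap_injective _ _).2 hinj
  have : IsDomain D[X] := inferInstance
  have : Module.IsTorsionFree D[X] M := FaithfulSMul.to_isTorsionFree D[X] M
  let f : Wf D →ₐ[D[X]] M := IsAlgClosed.lift
  refine ⟨f.toRingHom, RingHom.ext fun d => ?_, ?_⟩
  · exact (f.commutes (C d)).trans (eval₂_C e m)
  · exact (f.commutes X).trans (eval₂_X e m)

instance [Countable D] : Countable (Wf D) := by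
  have := Algebra.IsAlgebraic.cardinalMk_le_max D[X] (Wf D)
  exact Cardinal.mk_le_aleph0_iff.1 (this.trans (by simp))

/-- The subfield `k(T)` of `Wf D`, for a subfield `k` of `D`. -/
def ratSub (k : Subfield D) : Subfield (Wf D) := adj (k.map (cst D)) (tt D)

/-- The map from `k[T]` to `Wf D`. -/
def polSub (k : Subfield D) : k[X] →+* Wf D :=
  (algebraMap D[X] (Wf D)).comp (mapRingHom k.subtype)

theorem polSub_C (k : Subfield D) (a : k) : polSub k (C a) = cst D a := by
  simp [polSub, cst]

theorem polSub_X (k : Subfield D) : polSub k X = tt D := by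
  simp [polSub, tt]

theorem polSub_injective (k : Subfield D) : Function.Injective (polSub k) :=
  algebraMap_Wf_injective.comp (map_injective _ k.subtype.injective)

theorem polSub_eq_sum (k : Subfield D) (p : k[X]) {N : ℕ} (hN : p.natDegree < N) :
    polSub k p = ∑ l ∈ Finset.range N, cst D (p.coeff l) * tt D ^ l := by
  conv_lhs => rw [p.as_sum_range' N hN]
  simp_rw [map_sum, ← C_mul_X_pow_eq_monomial, map_mul, map_pow, polSub_C, polSub_X]

theorem cst_mem_ratSub {k : Subfield D} {a : D} (ha : a ∈ k) : cst D a ∈ ratSub k :=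
  le_adj _ _ ⟨a, ha, rfl⟩

theorem tt_mem_ratSub (k : Subfield D) : tt D ∈ ratSub k := self_mem_adj _ _

theorem polSub_mem_ratSub (k : Subfield D) (p : k[X]) : polSub k p ∈ ratSub k := by
  rw [polSub_eq_sum k p (Nat.lt_succ_self _)]
  exact sum_mem fun l _ => mul_mem (cst_mem_ratSub (p.coeff l).2) (pow_mem (tt_mem_ratSub k) _)

theorem ratSub_mono {k k' : Subfield D} (h : k ≤ k') : ratSub k ≤ ratSub k' :=
  adj_mono ((Subfield.gc_map_comap _).monotone_l h) _

/-- The map from `k(T)` to `Wf D`. -/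
def fracSub (k : Subfield D) : FractionRing k[X] →+* Wf D :=
  IsFractionRing.lift (polSub_injective k)

theorem fracSub_algebraMap (k : Subfield D) (p : k[X]) :
    fracSub k (algebraMap k[X] (FractionRing k[X]) p) = polSub k p :=
  IsFractionRing.lift_algebraMap _ _

theorem mem_ratSub_iff {k : Subfield D} {x : Wf D} : x ∈ ratSub k ↔ ∃ y, fracSub k y = x := by
  constructor
  · intro hx
    have : ratSub k ≤ (fracSub k).fieldRange := by
      refine adj_le ?_ ⟨_, (fracSub_algebraMap k X).trans (polSub_X k)⟩
      rintro _ ⟨a, ha, rfl⟩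
      exact ⟨_, (fracSub_algebraMap k (C ⟨a, ha⟩)).trans (polSub_C k _)⟩
    exact this hx
  · rintro ⟨y, rfl⟩
    obtain ⟨p, q, hq, rfl⟩ := IsFractionRing.div_surjective (A := k[X]) y
    rw [map_div₀, fracSub_algebraMap, fracSub_algebraMap]
    exact div_mem (polSub_mem_ratSub k p) (polSub_mem_ratSub k q)

theorem exists_polSub_of_integral {k : Subfield D} {x : Wf D} (hx : x ∈ ratSub k)
    (hi : (polSub k).IsIntegralElem x) : ∃ p, polSub k p = x := by
  obtain ⟨y, rfl⟩ := mem_ratSub_iff.1 hx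
  obtain ⟨g, hg, h0⟩ := hi
  have hy : IsIntegral k[X] y := by
    refine ⟨g, hg, (fracSub k).injective ?_⟩
    rw [hom_eval₂, map_zero, ← h0]
    rw [show (fracSub k).comp (algebraMap k[X] (FractionRing k[X])) = polSub k from
      RingHom.ext (fracSub_algebraMap k)]
  obtain ⟨p, rfl⟩ := IsIntegrallyClosed.isIntegral_iff.1 hy
  exact ⟨p, (fracSub_algebraMap k p).symm⟩

theorem exists_integral_multiple {k : Subfield D} (hk : ∀ d : D, IsAlgebraic k d) (x : Wf D) :
    ∃ q : k[X], q ≠ 0 ∧ (polSub k).IsIntegralElem (polSub k q * x) := by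
  let := (mapRingHom k.subtype).toAlgebra
  have : IsScalarTower k[X] D[X] (Wf D) := IsScalarTower.of_algebraMap_eq' rfl
  have : Algebra.IsAlgebraic k D := ⟨hk⟩
  have hintegral : Algebra.IsIntegral k[X] D[X] := by
    refine ⟨fun p => ?_⟩
    change (mapRingHom (algebraMap k D)).IsIntegralElem p
    exact Polynomial.isIntegral_iff_isIntegral_coeff.2 fun n =>
      (Algebra.IsIntegral.isIntegral (R := k) (p.coeff n))
  have : Algebra.IsAlgebraic k[X] (Wf D) := Algebra.IsAlgebraic.trans k[X] D[X] (Wf D)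
  obtain ⟨q, hq, h⟩ := (Algebra.IsAlgebraic.isAlgebraic (R := k[X]) x).exists_integral_multiple
  rw [Algebra.smul_def] at h
  exact ⟨q, hq, h⟩

theorem isAlgebraic_ratSub {k : Subfield D} (hk : ∀ d : D, IsAlgebraic k d) (x : Wf D) :
    IsAlgebraic (ratSub k) x := by
  obtain ⟨q, hq, g, hg, h0⟩ := exists_integral_multiple hk x
  let φ : k[X] →+* ratSub k := (polSub k).codRestrict _ (polSub_mem_ratSub k)
  have h1 : IsIntegral (ratSub k) (polSub k q * x) :=
    ⟨g.map φ, hg.map φ, by rw [eval₂_map]; exact h0⟩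
  have hq0 : polSub k q ≠ 0 := (map_ne_zero_iff _ (polSub_injective k)).2 hq
  have h2 : IsAlgebraic (ratSub k) ((polSub k q)⁻¹ * (polSub k q * x)) :=
    (isAlgebraic_algebraMap (⟨_, inv_mem (polSub_mem_ratSub k q)⟩ : ratSub k)).mul h1.isAlgebraic
  rwa [inv_mul_cancel_left₀ hq0] at h2

theorem mem_of_cst_mem_ratSub {k : Subfield D} {a : D} (h : cst D a ∈ ratSub k) : a ∈ k := by
  obtain ⟨y, hy⟩ := mem_ratSub_iff.1 h
  obtain ⟨p, q, hq, rfl⟩ := IsFractionRing.div_surjective (A := k[X]) y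
  have hq0 : q ≠ 0 := nonZeroDivisors.ne_zero hq
  rw [map_div₀, fracSub_algebraMap, fracSub_algebraMap,
    div_eq_iff ((map_ne_zero_iff _ (polSub_injective k)).2 hq0)] at hy
  have h1 : p.map k.subtype = C a * q.map k.subtype := by
    apply algebraMap_Wf_injective
    rw [map_mul]
    exact hy
  have h2 := congrArg (fun f => f.coeff q.natDegree) h1
  simp only [coeff_map, coeff_C_mul] at h2
  have h3 : (q.coeff q.natDegree : D) ≠ 0 := by
    rw [Ne, ZeroMemClass.coe_eq_zero]; exact leadingCoeff_ne_zero.2 hq0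
  rw [← div_eq_iff (b := (q.coeff q.natDegree : D)) h3 |>.2 h2]
  exact div_mem (p.coeff _).2 (q.coeff _).2

end

section
open Polynomial

theorem exists_clear_denominators {A K : Type*} [CommRing A] [IsDomain A] [Field K] [Algebra A K]
    [IsFractionRing A K] (p : K[X]) :
    ∃ (c : A) (P : A[X]), c ≠ 0 ∧ P.map (algebraMap A K) = C (algebraMap A K c) * p := by
  obtain ⟨c, hc, h⟩ := IsLocalization.integerNormalization_spec (nonZeroDivisors A) p
  refine ⟨c, IsLocalization.integerNormalization (nonZeroDivisors A) p,
    nonZeroDivisors.ne_zero hc, ?_⟩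
  rw [h, ← algebraMap_smul K c p, smul_eq_C_mul]

theorem exists_integral_minpoly {A K M : Type*} [CommRing A] [IsDomain A] [IsIntegrallyClosed A]
    [Field K] [Algebra A K] [IsFractionRing A K] [CharZero K] [Field M] (ψ : K →+* M) (κ : M)
    (hκ : ∃ a, a ≠ 0 ∧ ∃ p : K[X], p.Monic ∧ p.eval₂ ψ (ψ a * κ) = 0) (hne : ∀ y, ψ y ≠ κ) :
    ∃ q : A, q ≠ 0 ∧ ∃ f : A[X], f.Monic ∧
      f.eval₂ (ψ.comp (algebraMap A K)) (ψ (algebraMap A K q) * κ) = 0 ∧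
      (∀ y, (f.map (algebraMap A K)).eval y ≠ 0) ∧
      ∃ (u v : A[X]) (δ : A), δ ≠ 0 ∧ u * f + v * derivative f = C δ := by
  let := ψ.toAlgebra
  let := (ψ.comp (algebraMap A K)).toAlgebra
  have : IsScalarTower A K M := IsScalarTower.of_algebraMap_eq' rfl
  have hinj : Function.Injective (algebraMap A M) := ψ.injective.comp (IsFractionRing.injective A K)
  have : FaithfulSMul A M := (faithfulSMul_iff_algebraMap_injective _ _).2 hinj
  have : Module.IsTorsionFree A M := FaithfulSMul.to_isTorsionFree A M
  have hκ' : IsAlgebraic A κ := by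
    obtain ⟨a, ha, p, hp, h0⟩ := hκ
    rw [IsFractionRing.isAlgebraic_iff A K M]
    have h1 : IsAlgebraic K (ψ a * κ) := ⟨p, hp.ne_zero, h0⟩
    have h2 := (isAlgebraic_algebraMap (R := K) (A := M) a⁻¹).mul h1
    rwa [show algebraMap K M a⁻¹ = (ψ a)⁻¹ from map_inv₀ ψ a,
      inv_mul_cancel_left₀ ((map_ne_zero ψ).2 ha)] at h2
  obtain ⟨q, hq, hi⟩ := hκ'.exists_integral_multiple
  rw [Algebra.smul_def] at hi
  set w : M := algebraMap A M q * κ with hw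
  have hmap : minpoly K w = (minpoly A w).map (algebraMap A K) :=
    minpoly.isIntegrallyClosed_eq_field_fractions' K hi
  have hiK : IsIntegral K w := hi.tower_top
  have hq0 : algebraMap A M q ≠ 0 := (map_ne_zero_iff _ hinj).2 hq
  refine ⟨q, hq, minpoly A w, minpoly.monic hi, minpoly.aeval A w, fun y hy => ?_, ?_⟩
  · rw [← hmap] at hy
    have h1 := minpoly.root hiK hy
    refine hne (y / algebraMap A K q) ?_
    rw [map_div₀, div_eq_iff]
    · rw [mul_comm]; exact h1
    · exact hq0
  · obtain ⟨a, b, hab⟩ := (minpoly.irreducible hiK).separable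
    obtain ⟨b₁, P₁, hb₁, h₁⟩ := exists_clear_denominators (A := A) a
    obtain ⟨b₂, P₂, hb₂, h₂⟩ := exists_clear_denominators (A := A) b
    refine ⟨C b₂ * P₁, C b₁ * P₂, b₁ * b₂, mul_ne_zero hb₁ hb₂, ?_⟩
    apply map_injective (algebraMap A K) (IsFractionRing.injective A K)
    rw [hmap, derivative_map] at hab
    rw [Polynomial.map_add, Polynomial.map_mul, Polynomial.map_mul, Polynomial.map_mul,
      Polynomial.map_mul, h₁, h₂, map_C, map_C, map_C, map_mul, C_mul]
    linear_combination (C (algebraMap A K b₁) * C (algebraMap A K b₂)) * hab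

theorem eval₂_constG {ι K : Type*} [Field K] (U : Ultrafilter ι) (p : K[X]) (s : ι → K) :
    p.eval₂ (constG U) (mkG U s) = mkG U (fun i => p.eval (s i)) := by
  rw [constG, ← hom_eval₂]
  congr 1
  ext i
  change Pi.evalRingHom (fun _ => K) i _ = _
  rw [hom_eval₂]
  rfl

/-- Specialization of `T` at the integers. -/
theorem exists_specialization : ∃ Θ : Wf Qbar →+* UPow hilbertUltrafilter Qbar,
    Θ.comp (cst Qbar) = constG hilbertUltrafilter ∧
      Θ (tt Qbar) = mkG hilbertUltrafilter (fun c => (c : Qbar)) := by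
  refine exists_lift _ _ fun p hp => ?_
  rw [eval₂_constG, ← map_zero (mkG hilbertUltrafilter), mkG_eq] at hp
  by_contra h0
  have hfin : {c : ℤ | p.eval (c : Qbar) = 0}.Finite :=
    Set.Finite.preimage (f := fun t : ℤ => (t : Qbar)) (Int.cast_injective.injOn)
      (finite_setOfPred_isRoot h0)
  have h1 : ∀ᶠ c : ℤ in (hilbertUltrafilter : Filter ℤ), ¬ p.eval (c : Qbar) = 0 :=
    (hilbertUltrafilter_le.trans hilbertFilter_le_cofinite) hfin.compl_mem_cofinite
  obtain ⟨c, h2, h3⟩ := (hp.and h1).exists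
  exact h3 h2

theorem isFractionRing_polynomial {A K : Type*} [CommRing A] [IsDomain A] [Field K] [Algebra A K]
    [IsFractionRing A K] :
    let := ((algebraMap K[X] (FractionRing K[X])).comp (mapRingHom (algebraMap A K))).toAlgebra
    IsFractionRing A[X] (FractionRing K[X]) := by
  intro
  have hinj : Function.Injective (algebraMap A[X] (FractionRing K[X])) :=
    (IsFractionRing.injective K[X] (FractionRing K[X])).comp
      (map_injective _ (IsFractionRing.injective A K))
  have : FaithfulSMul A[X] (FractionRing K[X]) :=
    (faithfulSMul_iff_algebraMap_injective _ _).2 hinj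
  refine IsFractionRing.of_field _ _ fun z => ?_
  obtain ⟨a, b, hb, rfl⟩ := IsFractionRing.div_surjective (A := K[X]) z
  obtain ⟨b₁, P₁, hb₁, h₁⟩ := exists_clear_denominators (A := A) a
  obtain ⟨b₂, P₂, hb₂, h₂⟩ := exists_clear_denominators (A := A) b
  refine ⟨C b₂ * P₁, C b₁ * P₂, ?_⟩
  have h4 (c : A) (hc : c ≠ 0) : algebraMap K[X] (FractionRing K[X]) (C (algebraMap A K c)) ≠ 0 := by
    rw [map_ne_zero_iff _ (IsFractionRing.injective _ _), Ne, C_eq_zero,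
      map_eq_zero_iff _ (IsFractionRing.injective A K)]
    exact hc
  have hb' : algebraMap K[X] (FractionRing K[X]) b ≠ 0 := by
    rw [map_ne_zero_iff _ (IsFractionRing.injective _ _)]
    exact nonZeroDivisors.ne_zero hb
  change _ = algebraMap K[X] (FractionRing K[X]) (Polynomial.map (algebraMap A K) _) /
    algebraMap K[X] (FractionRing K[X]) (Polynomial.map (algebraMap A K) _)
  rw [Polynomial.map_mul, Polynomial.map_mul, h₁, h₂, map_C, map_C, map_mul, map_mul, map_mul,
    map_mul]
  have := h4 b₁ hb₁
  have := h4 b₂ hb₂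
  field_simp

end

section
open Polynomial

theorem isAlgebraic_subfield_Qbar (E : Subfield Qbar) (d : Qbar) : IsAlgebraic E d := by
  obtain ⟨p, hp, h⟩ := AlgebraicClosure.isAlgebraic ℚ |>.isAlgebraic d
  refine ⟨p.map (algebraMap ℚ E), (Polynomial.map_ne_zero_iff (algebraMap ℚ E).injective).2 hp, ?_⟩
  rw [aeval_def, eval₂_map, ← h, aeval_def]
  congr 1

/-- Hilbert's irreducibility theorem: an algebraic function over a number field `E` with
`E`-rational values at generic integers is a rational function over `E`. -/
theorem mem_ratSub_of_specialization (Θ : Wf Qbar →+* UPow hilbertUltrafilter Qbar)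
    (hΘ : Θ.comp (cst Qbar) = constG hilbertUltrafilter)
    (hT : Θ (tt Qbar) = mkG hilbertUltrafilter (fun c => (c : Qbar)))
    (E : Subfield Qbar) [NumberField E] (κ : Wf Qbar)
    (h : Θ κ ∈ internal hilbertUltrafilter (fun _ => E)) : κ ∈ ratSub E := by
  by_contra hκ
  let := ((algebraMap E[X] (FractionRing E[X])).comp
    (mapRingHom (algebraMap (NumberField.RingOfIntegers E) E))).toAlgebra
  have : IsFractionRing (NumberField.RingOfIntegers E)[X] (FractionRing E[X]) :=
    isFractionRing_polynomial
  have : CharZero (FractionRing E[X]) := (RingHom.charZero_iff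
    ((algebraMap E[X] (FractionRing E[X])).comp C).injective).1 inferInstance
  have halg : ∃ a, a ≠ 0 ∧ ∃ p : (FractionRing E[X])[X], p.Monic ∧
      p.eval₂ (fracSub E) (fracSub E a * κ) = 0 := by
    obtain ⟨q, hq, g, hg, h0⟩ := exists_integral_multiple (isAlgebraic_subfield_Qbar E) κ
    refine ⟨algebraMap E[X] _ q, (map_ne_zero_iff _ (IsFractionRing.injective _ _)).2 hq,
      g.map (algebraMap E[X] _), hg.map _, ?_⟩
    rw [eval₂_map, fracSub_algebraMap, show (fracSub E).comp (algebraMap E[X] (FractionRing E[X])) =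
      polSub E from RingHom.ext (fracSub_algebraMap E)]
    exact h0
  obtain ⟨q, hq, f, hf, h0, hroot, hsep⟩ := exists_integral_minpoly
    (A := (NumberField.RingOfIntegers E)[X]) (fracSub E) κ halg
    fun y hy => hκ (mem_ratSub_iff.2 ⟨y, hy⟩)
  have hthin := isHilbertThin_setOf_root f hf (by
    intro y
    rw [Polynomial.map_map]
    exact hroot y) hsep
  have hgen := hilbertUltrafilter_le (show {t : ℤ | ∃ x : NumberField.RingOfIntegers E,
      f.evalEval (t : NumberField.RingOfIntegers E) x = 0}ᶜ ∈ hilbertFilter by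
    change IsHilbertThin _
    rwa [compl_compl])
  let ev : (NumberField.RingOfIntegers E)[X] →+* (ℤ → Qbar) := RingHom.pi fun c =>
    (E.subtype.comp (algebraMap (NumberField.RingOfIntegers E) E)).comp
      (evalRingHom (c : NumberField.RingOfIntegers E))
  have hev (p : (NumberField.RingOfIntegers E)[X]) (c : ℤ) : ev p c = E.subtype
      (algebraMap (NumberField.RingOfIntegers E) E (p.eval (c : NumberField.RingOfIntegers E))) :=
    rfl
  let P : (NumberField.RingOfIntegers E)[X] →+* Wf Qbar := (fracSub E).comp (algebraMap _ _)
  have hP (p : (NumberField.RingOfIntegers E)[X]) :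
      P p = polSub E (p.map (algebraMap (NumberField.RingOfIntegers E) E)) :=
    fracSub_algebraMap E _
  have hcomp : Θ.comp P = (mkG hilbertUltrafilter).comp ev := by
    refine ringHom_ext (fun a => ?_) ?_
    · rw [RingHom.comp_apply, hP, map_C, polSub_C]
      refine (RingHom.congr_fun hΘ _).trans ?_
      rw [constG_eq, RingHom.comp_apply]
      congr 1
      ext c
      simp [hev]
    · rw [RingHom.comp_apply, hP, map_X, polSub_X, hT, RingHom.comp_apply]
      congr 1
      ext c
      simp [hev]
  obtain ⟨k', hk'⟩ := exists_mkG _ (Θ κ)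
  have hk'E : ∀ᶠ c : ℤ in (hilbertUltrafilter : Filter ℤ), k' c ∈ E := by
    rwa [← mkG_mem_internal (F := fun _ => E), hk']
  have hw : Θ (P q * κ) = mkG hilbertUltrafilter (ev q * k') := by
    rw [map_mul, map_mul, hk', ← RingHom.comp_apply, hcomp, RingHom.comp_apply]
  have h1 : mkG hilbertUltrafilter (f.eval₂ ev (ev q * k')) = mkG hilbertUltrafilter 0 := by
    have h2 := congrArg Θ h0
    change Θ (f.eval₂ P (P q * κ)) = _ at h2
    rw [hom_eval₂, hcomp, hw, map_zero, ← hom_eval₂] at h2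
    rw [h2, map_zero]
  rw [mkG_eq] at h1
  obtain ⟨c, hc, hcE, hc0⟩ := (Filter.Eventually.and hgen (hk'E.and h1)).exists
  apply hc
  set w : E := ⟨ev q c * k' c, mul_mem (SetLike.coe_mem _) hcE⟩ with hwdef
  have h3 : f.eval₂ ((algebraMap (NumberField.RingOfIntegers E) E).comp
      (evalRingHom (c : NumberField.RingOfIntegers E))) w = 0 := by
    apply E.subtype.injective
    rw [hom_eval₂, map_zero]
    have h4 : Pi.evalRingHom (fun _ => Qbar) c (f.eval₂ ev (ev q * k')) = 0 := hc0
    rw [hom_eval₂] at h4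
    exact h4
  have hintegral : IsIntegral (NumberField.RingOfIntegers E) w :=
    ⟨f.map (evalRingHom (c : NumberField.RingOfIntegers E)), hf.map _, by rw [eval₂_map]; exact h3⟩
  obtain ⟨x, hx⟩ := IsIntegrallyClosed.isIntegral_iff.1 hintegral
  refine ⟨x, ?_⟩
  apply FaithfulSMul.algebraMap_injective (NumberField.RingOfIntegers E) E
  rw [← hx, ← hom_eval₂, eval₂_evalRingHom] at h3
  rw [h3, map_zero]

end

section
open Polynomial

theorem comap_specialization (Θ : Wf Qbar →+* UPow hilbertUltrafilter Qbar)
    (hΘ : Θ.comp (cst Qbar) = constG hilbertUltrafilter)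
    (hT : Θ (tt Qbar) = mkG hilbertUltrafilter (fun c => (c : Qbar)))
    (E : Subfield Qbar) [NumberField E] :
    (internal hilbertUltrafilter (fun _ => E)).comap Θ = ratSub E := by
  refine le_antisymm (fun κ h => mem_ratSub_of_specialization Θ hΘ hT E κ h) (adj_le ?_ ?_)
  · rintro _ ⟨a, ha, rfl⟩
    rw [Subfield.mem_comap, ← RingHom.comp_apply, hΘ]
    exact ⟨fun _ => a, fun _ => ha, rfl⟩
  · rw [Subfield.mem_comap, hT]
    exact ⟨_, fun c => intCast_mem E c, rfl⟩

theorem eventually_mem_adj_specialization (Θ : Wf Qbar →+* UPow hilbertUltrafilter Qbar)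
    (hΘ : Θ.comp (cst Qbar) = constG hilbertUltrafilter)
    (hT : Θ (tt Qbar) = mkG hilbertUltrafilter (fun c => (c : Qbar)))
    (E : Subfield Qbar) [NumberField E] (π : Wf Qbar → ℤ → Qbar)
    (hπ : ∀ x, mkG hilbertUltrafilter (π x) = Θ x) (s x : Wf Qbar) :
    (∀ᶠ c in (hilbertUltrafilter : Filter ℤ), π x c ∈ adj E (π s c)) ↔ x ∈ adj (ratSub E) s := by
  have h := comap_specialization Θ hΘ hT E
  rw [mem_adj_iff_eventually Θ E (fun d => ?_) s x _ _ (hπ s) (hπ x), h]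
  rw [h]
  exact isAlgebraic_ratSub (isAlgebraic_subfield_Qbar E) d

theorem tt_ne_cst {D : Type*} [Field D] (z : D) : tt D ≠ cst D z := fun h =>
  X_ne_C z (algebraMap_Wf_injective h)

/-- The number field generated by a finite set. -/
def numSub (t : Finset Qbar) : Subfield Qbar := (IntermediateField.adjoin ℚ (t : Set Qbar)).toSubfield

theorem numSub_le_iff {t : Finset Qbar} {F : Subfield Qbar} : numSub t ≤ F ↔ ∀ a ∈ t, a ∈ F := by
  rw [numSub, IntermediateField.adjoin_toSubfield, Subfield.closure_le]
  constructor
  · exact fun h a ha => h (Or.inr ha)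
  · rintro h x (⟨q, rfl⟩ | hx)
    · rw [eq_ratCast]; exact SubfieldClass.ratCast_mem F q
    · exact h x hx

theorem subset_numSub {t : Finset Qbar} {a : Qbar} (ha : a ∈ t) : a ∈ numSub t :=
  IntermediateField.subset_adjoin ℚ (t : Set Qbar) ha

theorem numSub_mono {t t' : Finset Qbar} (h : t ⊆ t') : numSub t ≤ numSub t' :=
  numSub_le_iff.2 fun _ ha => subset_numSub (h ha)

instance (t : Finset Qbar) : NumberField (numSub t) where
  to_finiteDimensional := by
    have : FiniteDimensional ℚ (IntermediateField.adjoin ℚ (t : Set Qbar)) :=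
      IntermediateField.finiteDimensional_adjoin fun x _ =>
        (AlgebraicClosure.isAlgebraic ℚ |>.isAlgebraic x).isIntegral
    let f : IntermediateField.adjoin ℚ (t : Set Qbar) →+ numSub t :=
      { toFun := fun x => ⟨x, x.2⟩, map_zero' := rfl, map_add' := fun _ _ => rfl }
    refine Module.Finite.of_surjective (f.toRatLinearMap) fun x => ⟨⟨x, x.2⟩, rfl⟩

theorem exists_numSub_of_mem_adj {F : Subfield Qbar} {s y : Wf Qbar} (hy : y ∈ adj (ratSub F) s) :
    ∃ t : Finset Qbar, (∀ a ∈ t, a ∈ F) ∧ y ∈ adj (ratSub (numSub t)) s := by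
  classical
  have hdir : Directed (· ≤ ·) fun t : {t : Finset Qbar // ∀ a ∈ t, a ∈ F} =>
      adj (ratSub (numSub t.1)) s := by
    intro t t'
    refine ⟨⟨t.1 ∪ t'.1, fun a ha => ?_⟩, ?_, ?_⟩
    · rcases Finset.mem_union.1 ha with h | h
      exacts [t.2 a h, t'.2 a h]
    · exact adj_mono (ratSub_mono (numSub_mono Finset.subset_union_left)) s
    · exact adj_mono (ratSub_mono (numSub_mono Finset.subset_union_right)) s
  have : Nonempty {t : Finset Qbar // ∀ a ∈ t, a ∈ F} := ⟨⟨∅, by simp⟩⟩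
  have hle : adj (ratSub F) s ≤
      ⨆ t : {t : Finset Qbar // ∀ a ∈ t, a ∈ F}, adj (ratSub (numSub t.1)) s := by
    refine adj_le (adj_le ?_ ?_) ?_
    · rintro _ ⟨a, ha, rfl⟩
      exact (Subfield.mem_iSup_of_directed hdir).2 ⟨⟨{a}, by simpa using ha⟩,
        le_adj _ _ (cst_mem_ratSub (subset_numSub (by simp)))⟩
    · exact (Subfield.mem_iSup_of_directed hdir).2 ⟨⟨∅, by simp⟩, le_adj _ _ (tt_mem_ratSub _)⟩
    · exact (Subfield.mem_iSup_of_directed hdir).2 ⟨⟨∅, by simp⟩, self_mem_adj _ _⟩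
  obtain ⟨t, ht⟩ := (Subfield.mem_iSup_of_directed hdir).1 (hle hy)
  exact ⟨t.1, t.2, ht⟩

theorem exists_numSub_of_forall_mem_adj {F : Subfield Qbar} {s : Wf Qbar} (S : Finset (Wf Qbar))
    (hS : ∀ y ∈ S, y ∈ adj (ratSub F) s) (I : Finset Qbar) (hI : ∀ a ∈ I, a ∈ F) :
    ∃ t : Finset Qbar, I ⊆ t ∧ (∀ a ∈ t, a ∈ F) ∧ ∀ y ∈ S, y ∈ adj (ratSub (numSub t)) s := by
  classical
  choose! t ht using fun y (hy : y ∈ S) => exists_numSub_of_mem_adj (hS y hy)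
  refine ⟨I ∪ S.biUnion t, Finset.subset_union_left, fun a ha => ?_, fun y hy => ?_⟩
  · rcases Finset.mem_union.1 ha with h | h
    · exact hI a h
    · obtain ⟨y, hy, h⟩ := Finset.mem_biUnion.1 h
      exact (ht y hy).1 a h
  · exact adj_mono (ratSub_mono (numSub_mono ((Finset.subset_biUnion_of_mem t hy).trans
      Finset.subset_union_right))) s (ht y hy).2

end

section

theorem exists_finset_of_isOpen {U : Set (Subfield Qbar)} (hU : IsOpen U) {F : Subfield Qbar}
    (hF : F ∈ U) : ∃ I : Finset Qbar, ∀ F' : Subfield Qbar, (∀ a ∈ I, a ∈ F' ↔ a ∈ F) → F' ∈ U := by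
  obtain ⟨V, hV, rfl⟩ := hU
  let := propDiscrete
  obtain ⟨I, u, hu, hV⟩ := isOpen_pi_iff.1 hV _ hF
  refine ⟨I, fun F' h => hV fun a ha => ?_⟩
  have h1 : (F' : Set Qbar) a = (F : Set Qbar) a := propext (h a ha)
  change (F' : Set Qbar) a ∈ u a
  exact h1.symm ▸ (hu a ha).2

theorem isOpen_of_finset {U : Set (Subfield Qbar)} (h : ∀ F ∈ U, ∃ I : Finset Qbar,
    ∀ F' : Subfield Qbar, (∀ a ∈ I, a ∈ F' ↔ a ∈ F) → F' ∈ U) : IsOpen U := by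
  let := propDiscrete
  have : DiscreteTopology Prop := ⟨rfl⟩
  choose! I hI using h
  refine ⟨(⋃ F ∈ U, {f : Qbar → Prop | ∀ a ∈ I F, f a = (a ∈ F)} : Set (Qbar → Prop)), ?_, ?_⟩
  · change IsOpen (⋃ F ∈ U, {f : Qbar → Prop | ∀ a ∈ I F, f a = (a ∈ F)} : Set (Qbar → Prop))
    refine isOpen_iUnion fun F => isOpen_iUnion fun hF => ?_
    refine isOpen_pi_iff.2 fun f hf => ⟨I F, fun a => {a ∈ F}, fun a ha =>
      ⟨isOpen_discrete _, hf a ha⟩, fun g hg a ha => hg a ha⟩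
  · ext F'
    constructor
    · intro h
      obtain ⟨F, hF, h⟩ := Set.mem_iUnion₂.1 h
      exact hI F hF F' fun a ha => iff_of_eq (h a ha)
    · exact fun h => Set.mem_iUnion₂.2 ⟨F', h, fun a _ => rfl⟩

/-- Partial homomorphisms over the constants, on finite sets of algebraic functions. -/
def IsPartHom (S : Finset (Wf Qbar)) (h : Wf Qbar → Qbar) : Prop :=
  (∀ x ∈ S, ∀ a, cst Qbar a = x → h x = a) ∧
    ∀ x ∈ S, ∀ y ∈ S, h (x + y) = h x + h y ∧ h (x * y) = h x * h y

/-- Every one-parameter regular extension of `F` has specializations reflecting membership. -/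
def SpecProp (F : Subfield Qbar) : Prop :=
  ∀ s : Wf Qbar, (∀ a, cst Qbar a ∈ adj (ratSub F) s → a ∈ F) →
    ∀ (S : Finset (Wf Qbar)) (z : Qbar), ∃ h : Wf Qbar → Qbar, IsPartHom S h ∧
      (∀ x ∈ S, h x ∈ F ↔ x ∈ adj (ratSub F) s) ∧ h (tt Qbar) ≠ z

/-- The open set of fields with a specialization of prescribed type. -/
def specSet (S S₁ : Finset (Wf Qbar)) (z : Qbar) : Set (Subfield Qbar) :=
  {F | ∃ h : Wf Qbar → Qbar, IsPartHom S h ∧ (∀ x ∈ S, h x ∈ F ↔ x ∈ S₁) ∧ h (tt Qbar) ≠ z}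

theorem isOpen_specSet (S S₁ : Finset (Wf Qbar)) (z : Qbar) : IsOpen (specSet S S₁ z) := by
  classical
  refine isOpen_of_finset ?_
  rintro F ⟨h, h1, h2, h3⟩
  refine ⟨S.image h, fun F' hF' => ⟨h, h1, fun x hx => ?_, h3⟩⟩
  rw [hF' (h x) (Finset.mem_image_of_mem h hx), h2 x hx]

/-- Generic specializations. -/
theorem exists_generic_specialization (E : Subfield Qbar) [NumberField E]
    (R S : Finset (Wf Qbar)) (z : Qbar) : ∃ h : Wf Qbar → Qbar, IsPartHom S h ∧
      (∀ s ∈ R, ∀ x ∈ S, h x ∈ adj E (h s) ↔ x ∈ adj (ratSub E) s) ∧ h (tt Qbar) ≠ z := by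
  obtain ⟨Θ, hΘ, hT⟩ := exists_specialization
  choose π hπ using fun x => exists_mkG hilbertUltrafilter (Θ x)
  have hc (a : Qbar) : Θ (cst Qbar a) = mkG hilbertUltrafilter fun _ => a := RingHom.congr_fun hΘ a
  have h1 : ∀ᶠ c in (hilbertUltrafilter : Filter ℤ), ∀ x ∈ S, ∀ a, cst Qbar a = x → π x c = a := by
    rw [Filter.eventually_all_finset]
    intro x _
    by_cases hx : ∃ a, cst Qbar a = x
    · obtain ⟨a, rfl⟩ := hx
      have h := (hπ (cst Qbar a)).trans (hc a)
      filter_upwards [(mkG_eq _).1 h] with c hc b hb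
      rw [hc, (cst Qbar).injective hb]
    · exact Filter.Eventually.of_forall fun c a ha => absurd ⟨a, ha⟩ hx
  have h2 : ∀ᶠ c in (hilbertUltrafilter : Filter ℤ), ∀ x ∈ S, ∀ y ∈ S,
      π (x + y) c = π x c + π y c ∧ π (x * y) c = π x c * π y c := by
    simp_rw [Filter.eventually_all_finset]
    intro x _ y _
    have ha : mkG hilbertUltrafilter (π (x + y)) = mkG hilbertUltrafilter (π x + π y) := by
      rw [map_add, hπ, hπ, hπ, map_add]
    have hm : mkG hilbertUltrafilter (π (x * y)) = mkG hilbertUltrafilter (π x * π y) := by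
      rw [map_mul, hπ, hπ, hπ, map_mul]
    exact ((mkG_eq _).1 ha).and ((mkG_eq _).1 hm)
  have h3 : ∀ᶠ c in (hilbertUltrafilter : Filter ℤ), ∀ s ∈ R, ∀ x ∈ S,
      π x c ∈ adj E (π s c) ↔ x ∈ adj (ratSub E) s := by
    simp_rw [Filter.eventually_all_finset]
    intro s _ x _
    have h := eventually_mem_adj_specialization Θ hΘ hT E π hπ s x
    by_cases hx : x ∈ adj (ratSub E) s
    · filter_upwards [h.2 hx] with c hc
      exact iff_of_true hc hx
    · filter_upwards [Ultrafilter.eventually_not.2 (mt h.1 hx)] with c hc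
      exact iff_of_false hc hx
  have h4 : ∀ᶠ c in (hilbertUltrafilter : Filter ℤ), π (tt Qbar) c ≠ z := by
    refine Ultrafilter.eventually_not.2 fun h => tt_ne_cst z (Θ.injective ?_)
    rw [hc, ← hπ, mkG_eq]
    exact h
  obtain ⟨c, h1, h2, h3, h4⟩ := (h1.and (h2.and (h3.and h4))).exists
  exact ⟨fun x => π x c, ⟨h1, h2⟩, h3, h4⟩

theorem specProp_of_notMem_frontier {F : Subfield Qbar}
    (hF : ∀ S S₁ z, F ∉ frontier (specSet S S₁ z)) : SpecProp F := by
  classical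
  intro s hs S z
  have h0 := hF S (S.filter fun x => x ∈ adj (ratSub F) s) z
  rw [(isOpen_specSet _ _ _).frontier_eq, Set.mem_sdiff, not_and, not_not] at h0
  obtain ⟨h, h1, h2, h3⟩ := h0 (by
    rw [mem_closure_iff]
    intro U hU hFU
    obtain ⟨I, hI⟩ := exists_finset_of_isOpen hU hFU
    obtain ⟨t, hIt, htF, ht⟩ := exists_numSub_of_forall_mem_adj (F := F) (s := s)
      (S.filter fun x => x ∈ adj (ratSub F) s) (fun y hy => (Finset.mem_filter.1 hy).2)
      (I.filter fun a => a ∈ F) (fun a ha => (Finset.mem_filter.1 ha).2)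
    have hEF : numSub t ≤ F := numSub_le_iff.2 htF
    have hle : adj (ratSub (numSub t)) s ≤ adj (ratSub F) s := adj_mono (ratSub_mono hEF) s
    obtain ⟨h, hh, hh', hz⟩ := exists_generic_specialization (numSub t) {s}
      (S ∪ I.image (cst Qbar)) z
    replace hh' := hh' s (Finset.mem_singleton_self s)
    refine ⟨adj (numSub t) (h s), hI _ fun a ha => ?_, h, ⟨fun x hx => hh.1 x
      (Finset.mem_union_left _ hx), fun x hx y hy => hh.2 x (Finset.mem_union_left _ hx) y
      (Finset.mem_union_left _ hy)⟩, fun x hx => ?_, hz⟩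
    · have hmem : cst Qbar a ∈ S ∪ I.image (cst Qbar) :=
        Finset.mem_union_right _ (Finset.mem_image_of_mem _ ha)
      constructor
      · intro h
        rw [← hh.1 _ hmem a rfl, hh' _ hmem] at h
        exact hs a (hle h)
      · exact fun h => le_adj _ _ (subset_numSub (hIt (Finset.mem_filter.2 ⟨ha, h⟩)))
    · rw [hh' x (Finset.mem_union_left _ hx), Finset.mem_filter]
      exact ⟨fun h => ⟨hx, hle h⟩, fun h => ht x (Finset.mem_filter.2 h)⟩)
  exact ⟨h, h1, fun x hx => by rw [h2 x hx, Finset.mem_filter, and_iff_right hx], h3⟩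

theorem isMeagre_frontier {X : Type*} [TopologicalSpace X] {O : Set X} (hO : IsOpen O) :
    IsMeagre (frontier O) := by
  refine IsNowhereDense.isMeagre ?_
  rw [IsNowhereDense, isClosed_frontier.closure_eq, ← frontier_compl]
  exact interior_frontier hO.isClosed_compl

theorem isMeagre_not_specProp : IsMeagre {F : Subfield Qbar | ¬ SpecProp F} := by
  have : Countable Qbar := by
    have := @Algebra.IsAlgebraic.cardinalMk_le_max ℚ _ _ Qbar _ _ _ _
      (AlgebraicClosure.isAlgebraic ℚ)
    exact Cardinal.mk_le_aleph0_iff.1 (this.trans (by simp))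
  refine IsMeagre.mono ?_ (isMeagre_iUnion
    (f := fun p : Finset (Wf Qbar) × Finset (Wf Qbar) × Qbar => frontier (specSet p.1 p.2.1 p.2.2))
    fun p => isMeagre_frontier (isOpen_specSet _ _ _))
  intro F hF
  by_contra h
  refine hF (specProp_of_notMem_frontier fun S S₁ z hz => h ?_)
  exact Set.mem_iUnion.2 ⟨(S, S₁, z), hz⟩

end

section
open Polynomial

theorem transcendental_of_sq_eq_tt {D : Type*} [Field D] {s : Wf D} (hs : s ^ 2 = tt D) (p : D[X])
    (hp : p.eval₂ (cst D) s = 0) : p = 0 := by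
  by_contra h0
  have h1 : (∃ g : D[X], g ≠ 0 ∧ g.eval₂ (cst D) (tt D) = 0) := by
    let := (cst D).toAlgebra
    have h2 : IsAlgebraic D (s ^ 2) := IsAlgebraic.pow (⟨p, h0, hp⟩ : IsAlgebraic D s) 2
    rw [hs] at h2
    exact h2
  obtain ⟨g, hg, hg0⟩ := h1
  rw [eval₂_cst_tt, ← map_zero (algebraMap D[X] (Wf D))] at hg0
  exact hg (algebraMap_Wf_injective hg0)

theorem sqrt_tt_notMem_ratSub {D : Type*} [Field D] (k : Subfield D) {s : Wf D}
    (hs : s ^ 2 = tt D) : s ∉ ratSub k := by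
  intro h
  obtain ⟨p, rfl⟩ := exists_polSub_of_integral h ⟨X ^ 2 - C X, monic_X_pow_sub_C _ two_ne_zero, by
    simp [hs, polSub_X]⟩
  rw [← polSub_X k, ← map_pow] at hs
  have h1 := congrArg natDegree (polSub_injective k hs)
  rw [natDegree_pow, natDegree_X] at h1
  omega

theorem mem_of_cst_mem_adj_sqrt {D : Type*} [Field D] {k : Subfield D} {s : Wf D}
    (hs : s ^ 2 = tt D) {b : D} (hb : cst D b ∈ adj (ratSub k) s) : b ∈ k := by
  obtain ⟨e, he, hes⟩ := exists_lift (cst D) s (transcendental_of_sq_eq_tt hs)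
  have hc (a : D) : e (cst D a) = cst D a := RingHom.congr_fun he a
  have hle : adj (ratSub k) s ≤ (ratSub k).map e := by
    have h1 : s ∈ (ratSub k).map e := ⟨_, tt_mem_ratSub k, hes⟩
    refine adj_le (adj_le ?_ ?_) h1
    · rintro _ ⟨a, ha, rfl⟩
      exact ⟨_, cst_mem_ratSub ha, hc a⟩
    · rw [← hs]; exact pow_mem h1 2
  obtain ⟨y, hy, hy'⟩ := hle hb
  rw [← hc b] at hy'
  rw [e.injective hy'] at hy
  exact mem_of_cst_mem_ratSub hy

theorem isMeagre_singleton (K : Subfield Qbar) [NumberField K] : IsMeagre {K} := by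
  classical
  have hcl : IsClosed {K} := by
    rw [← isOpen_compl_iff]
    refine isOpen_of_finset fun F hF => ?_
    obtain ⟨a, ha⟩ : ∃ a, ¬ (a ∈ F ↔ a ∈ K) := by
      by_contra! h
      exact hF (SetLike.ext h)
    exact ⟨{a}, fun F' h h' => ha (by rw [← h a (by simp), h'])⟩
  refine IsNowhereDense.isMeagre ?_
  rw [IsNowhereDense, hcl.closure_eq, ← Set.subset_empty_iff]
  intro F hF
  have hFK : F = K := Set.mem_singleton_iff.1 (interior_subset hF)
  obtain ⟨I, hI⟩ := exists_finset_of_isOpen isOpen_interior hF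
  subst hFK
  obtain ⟨s, hs⟩ := IsAlgClosed.exists_pow_nat_eq (tt Qbar) (n := 2) (by simp)
  obtain ⟨h, h1, h2, -⟩ := exists_generic_specialization F {s, cst Qbar 0}
    ({s, cst Qbar 0} ∪ I.image (cst Qbar)) 0
  have h3 : adj F (h s) ∈ interior ({F} : Set (Subfield Qbar)) := hI _ fun a ha => by
    have hmem : cst Qbar a ∈ {s, cst Qbar 0} ∪ I.image (cst Qbar) :=
      Finset.mem_union_right _ (Finset.mem_image_of_mem _ ha)
    refine ⟨fun h => ?_, fun h => le_adj _ _ h⟩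
    rw [← h1.1 _ hmem a rfl, h2 s (by simp) _ hmem] at h
    exact mem_of_cst_mem_adj_sqrt hs h
  have h4 : adj F (h s) = F := Set.mem_singleton_iff.1 (interior_subset h3)
  have h5 : h s ∈ adj F (h (cst Qbar 0)) := le_adj _ _ (h4 ▸ self_mem_adj F (h s))
  rw [h2 _ (by simp) s (by simp)] at h5
  exact sqrt_tt_notMem_ratSub F hs (adj_le le_rfl (cst_mem_ratSub (zero_mem F)) h5)

end

section
open Polynomial

variable {ι K : Type*} [Field K] (U : Ultrafilter ι)

/-- The embedding of the ultrapower of `K` into the ultrapower of `Wf K`. -/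
def cstG : UPow U K →+* UPow U (Wf K) where
  toFun := Filter.Germ.map (cst K)
  map_one' := congrArg (mkG U) (funext fun _ => map_one (cst K))
  map_zero' := congrArg (mkG U) (funext fun _ => map_zero (cst K))
  map_mul' x y := by
    obtain ⟨f, rfl⟩ := exists_mkG U x
    obtain ⟨g, rfl⟩ := exists_mkG U y
    exact congrArg (mkG U) (funext fun _ => map_mul (cst K) _ _)
  map_add' x y := by
    obtain ⟨f, rfl⟩ := exists_mkG U x
    obtain ⟨g, rfl⟩ := exists_mkG U y
    exact congrArg (mkG U) (funext fun _ => map_add (cst K) _ _)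

theorem cstG_mkG (f : ι → K) : cstG U (mkG U f) = mkG U fun i => cst K (f i) := rfl

/-- The constant sequence `T`. -/
def ttG : UPow U (Wf K) := constG U (tt K)

theorem eval₂_cstG_mkG {R : Type*} [CommRing R] (φ : ι → R →+* K) (P : R[X]) :
    P.eval₂ ((cstG U).comp ((mkG U).comp (RingHom.pi φ))) (ttG U) =
      mkG U fun i => (P.map (φ i)).eval₂ (cst K) (tt K) := by
  have h : eval₂RingHom ((cstG U).comp ((mkG U).comp (RingHom.pi φ))) (ttG U) =
      (mkG U).comp (RingHom.pi fun i =>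
        (eval₂RingHom (cst K) (tt K)).comp (mapRingHom (φ i))) := by
    refine ringHom_ext (fun a => ?_) ?_
    · simp only [coe_eval₂RingHom, eval₂_C, RingHom.comp_apply, cstG_mkG]
      congr 1
      ext i
      simp
    · simp only [coe_eval₂RingHom, eval₂_X, RingHom.comp_apply, ttG, constG_eq]
      congr 1
      ext i
      simp
  exact RingHom.congr_fun h P

theorem eq_zero_of_eval₂_cstG (p : (UPow U K)[X]) (hp : p.eval₂ (cstG U) (ttG U) = 0) : p = 0 := by
  obtain ⟨P, rfl⟩ := map_surjective (mkG U) (fun x => exists_mkG U x) p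
  have h := eval₂_cstG_mkG U (fun i => Pi.evalRingHom (fun _ => K) i) P
  have h1 : (mkG U).comp (RingHom.pi fun i => Pi.evalRingHom (fun _ => K) i) = mkG U := rfl
  rw [h1, ← eval₂_map, hp, ← map_zero (mkG U), mkG_eq] at h
  ext l
  rw [coeff_map, coeff_zero, ← map_zero (mkG U), mkG_eq]
  filter_upwards [h] with i hi
  rw [eval₂_cst_tt] at hi
  have h2 : P.map (Pi.evalRingHom (fun _ => K) i) = 0 :=
    algebraMap_Wf_injective (by rw [map_zero]; exact hi.symm)
  simpa using congrArg (fun q => q.coeff l) h2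

theorem eval₂_cstG_injective {p q : (UPow U K)[X]}
    (h : p.eval₂ (cstG U) (ttG U) = q.eval₂ (cstG U) (ttG U)) : p = q := by
  rw [← sub_eq_zero]
  exact eq_zero_of_eval₂_cstG U _ (by rw [eval₂_sub, h, sub_self])

theorem natDegree_le_of_integral {R : Type*} [CommRing R] [IsDomain R] (g : R[X][X]) (hg : g.Monic)
    (N : ℕ) (hN : ∀ l, (g.coeff l).natDegree ≤ N) (P : R[X]) (hP : g.eval P = 0) :
    P.natDegree ≤ N := by
  by_contra! h
  have hP0 : P ≠ 0 := by rintro rfl; simp at h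
  rw [eval_eq_sum_range, Finset.sum_range_succ, hg.coeff_natDegree, one_mul] at hP
  have h1 := congrArg natDegree (eq_neg_of_add_eq_zero_right hP)
  rw [natDegree_pow, natDegree_neg] at h1
  rcases Nat.eq_zero_or_pos g.natDegree with h0 | h0
  · rw [h0] at hP
    simp at hP
  have h2 : (∑ l ∈ Finset.range g.natDegree, g.coeff l * P ^ l).natDegree ≤
      N + (g.natDegree - 1) * P.natDegree := by
    refine natDegree_sum_le_of_forall_le _ _ fun l hl => ?_
    rw [Finset.mem_range] at hl
    refine natDegree_mul_le.trans (add_le_add (hN l) ?_)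
    rw [natDegree_pow]
    exact Nat.mul_le_mul_right _ (by omega)
  rw [← h1] at h2
  obtain ⟨m, hm⟩ : ∃ m, g.natDegree = m + 1 := ⟨g.natDegree - 1, by omega⟩
  rw [hm, Nat.add_sub_cancel, add_mul] at h2
  omega

/-- Evaluation at the constant sequence `T` of polynomials with internal coefficients. -/
def intPol (F : Subfield K) : (internal U fun _ => F)[X] →+* UPow U (Wf K) :=
  eval₂RingHom ((cstG U).comp (Subfield.subtype _)) (ttG U)

theorem exists_intPol_of_integral (F : Subfield K) (g : (internal U fun _ => F)[X][X])
    (hg : g.Monic) (r : ι → Wf K) (hr : ∀ i, r i ∈ ratSub F)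
    (h0 : g.eval₂ (intPol U F) (mkG U r) = 0) : ∃ p, intPol U F p = mkG U r := by
  classical
  let φ (i : ι) : (ι → F) →+* K := F.subtype.comp (Pi.evalRingHom _ i)
  let π : (ι → F) →+* internal U fun _ => F :=
    ((mkG U).comp (RingHom.pi φ)).codRestrict _ fun f => ⟨_, fun i => (f i).2, rfl⟩
  have hπ : Function.Surjective π := by
    rintro ⟨_, f, hf, rfl⟩
    exact ⟨fun i => ⟨f i, hf i⟩, rfl⟩
  have hcomp : (Subfield.subtype _).comp π = (mkG U).comp (RingHom.pi φ) := rfl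
  have hpol (P : (ι → F)[X]) : intPol U F (P.map π) =
      mkG U fun i => polSub F (P.map (Pi.evalRingHom (fun _ => F) i)) := by
    rw [intPol, coe_eval₂RingHom, eval₂_map, RingHom.comp_assoc, hcomp, eval₂_cstG_mkG]
    congr 1
    ext i
    rw [eval₂_cst_tt, polSub, RingHom.comp_apply, coe_mapRingHom, Polynomial.map_map]
  obtain ⟨G, rfl, -, hGm⟩ := lifts_and_natDegree_eq_and_monic (f := mapRingHom π)
    ((mem_lifts _).2 (map_surjective _ (map_surjective _ hπ) g)) hg
  have hpol2 : (intPol U F).comp (mapRingHom π) =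
      (mkG U).comp (RingHom.pi fun i => (polSub F).comp (mapRingHom (Pi.evalRingHom (fun _ => F) i))) :=
    RingHom.ext hpol
  have hG : mkG U (fun i => (G.map (mapRingHom (Pi.evalRingHom (fun _ => F) i))).eval₂ (polSub F) (r i)) = 0 := by
    rw [← h0, eval₂_map, hpol2, ← hom_eval₂]
    congr 1
    ext i
    change _ = Pi.evalRingHom (fun _ => Wf K) i _
    rw [hom_eval₂, eval₂_map]
    rfl
  rw [← map_zero (mkG U), mkG_eq] at hG
  set N := G.support.sup fun l => (G.coeff l).natDegree with hNdef
  have hN (i : ι) (l : ℕ) :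
      ((G.map (mapRingHom (Pi.evalRingHom (fun _ => F) i))).coeff l).natDegree ≤ N := by
    rw [coeff_map, coe_mapRingHom]
    refine natDegree_map_le.trans ?_
    by_cases hl : l ∈ G.support
    · exact Finset.le_sup (f := fun l => (G.coeff l).natDegree) hl
    · rw [notMem_support_iff.1 hl]; simp
  have hex (i : ι) : ∃ P : F[X],
      (G.map (mapRingHom (Pi.evalRingHom (fun _ => F) i))).eval₂ (polSub F) (r i) = 0 →
        polSub F P = r i ∧ P.natDegree ≤ N := by
    by_cases hi : (G.map (mapRingHom (Pi.evalRingHom (fun _ => F) i))).eval₂ (polSub F) (r i) = 0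
    · obtain ⟨P, hP⟩ := exists_polSub_of_integral (hr i) ⟨_, hGm.map _, hi⟩
      refine ⟨P, fun _ => ⟨hP, natDegree_le_of_integral _ (hGm.map _) N (hN i) P ?_⟩⟩
      rw [← hP, eval₂_at_apply] at hi
      exact polSub_injective F (by rw [hi, map_zero])
    · exact ⟨0, fun h => absurd h hi⟩
  choose P hP using hex
  refine ⟨(∑ l ∈ Finset.range (N + 1), monomial l fun i => (P i).coeff l : (ι → F)[X]).map π, ?_⟩
  rw [hpol, mkG_eq]
  filter_upwards [hG] with i hi
  obtain ⟨h1, h2⟩ := hP i hi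
  rw [← h1, (P i).as_sum_range' (N + 1) (by omega), Polynomial.map_sum]
  simp

theorem isAlgebraic_comap_top {D M : Type*} [Field D] [Field M] (e : D →+* M) (d : D) :
    IsAlgebraic ((⊤ : Subfield M).comap e) d :=
  ⟨X - C ⟨d, trivial⟩, X_sub_C_ne_zero _, by simp [sub_eq_zero]; rfl⟩

end

section
open Polynomial

theorem isIntegralElem_coeff {R S : Type*} [CommRing R] [CommRing S] (φ : R →+* S) {p : S[X]}
    (h : (mapRingHom φ).IsIntegralElem p) (l : ℕ) : φ.IsIntegralElem (p.coeff l) := by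
  let := φ.toAlgebra
  let := Polynomial.algebra R S
  have h1 : IsIntegral R[X] p := h
  exact h1.coeff l

section
variable {ι K : Type*} [Field K] {U : Ultrafilter ι}
  {D : Type*} [Field D] {e : D →+* UPow U K} {j : Wf D →+* UPow U (Wf K)}

theorem exists_map_ultrapower [CharZero K] [IsAlgClosed K] (e : D →+* UPow U K) :
    ∃ j : Wf D →+* UPow U (Wf K), j.comp (cst D) = (cstG U).comp e ∧ j (tt D) = ttG U := by
  refine exists_lift _ _ fun p hp => ?_
  rw [← eval₂_map] at hp
  exact (Polynomial.map_eq_zero e).1 (eq_zero_of_eval₂_cstG U _ hp)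

theorem ratSub_le_comap (hj : j.comp (cst D) = (cstG U).comp e) (hjt : j (tt D) = ttG U)
    (F : Subfield K) :
    ratSub ((internal U fun _ => F).comap e) ≤ (internal U fun _ => ratSub F).comap j := by
  refine adj_le ?_ ?_
  · rintro _ ⟨a, ha, rfl⟩
    obtain ⟨f, hf, hfe⟩ := ha
    refine ⟨fun i => cst K (f i), fun i => cst_mem_ratSub (hf i), ?_⟩
    rw [← cstG_mkG, hfe]
    exact (RingHom.congr_fun hj a).symm
  · rw [Subfield.mem_comap, hjt]
    exact ⟨_, fun _ => tt_mem_ratSub F, rfl⟩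

theorem comap_internal_ratSub [CharZero D] [IsAlgClosed D]
    (hj : j.comp (cst D) = (cstG U).comp e) (hjt : j (tt D) = ttG U) (F : Subfield K)
    (hk : ∀ d : D, IsAlgebraic ((internal U fun _ => F).comap e) d) :
    (internal U fun _ => ratSub F).comap j = ratSub ((internal U fun _ => F).comap e) := by
  set k := (internal U fun _ => F).comap e with hkdef
  refine le_antisymm (fun x hx => ?_) (ratSub_le_comap hj hjt F)
  obtain ⟨q, hq, g, hg, h0⟩ := exists_integral_multiple hk x
  have hq0 : polSub k q ≠ 0 := (map_ne_zero_iff _ (polSub_injective k)).2 hq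
  set ρ := polSub k q * x with hρ
  suffices h : ρ ∈ ratSub k by
    rw [show x = ρ / polSub k q by rw [hρ]; field_simp]
    exact div_mem h (polSub_mem_ratSub k q)
  have hjρ : j ρ ∈ internal U fun _ => ratSub F := by
    rw [hρ, map_mul]
    exact mul_mem (ratSub_le_comap hj hjt F (polSub_mem_ratSub k q)) hx
  let ek : k →+* internal U fun _ => F := (e.comp k.subtype).codRestrict _ fun a => a.2
  have hjp : j.comp (polSub k) = (intPol U F).comp (mapRingHom ek) := by
    refine ringHom_ext (fun a => ?_) ?_
    · simp only [RingHom.comp_apply, polSub_C, coe_mapRingHom, map_C, intPol, coe_eval₂RingHom,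
        eval₂_C]
      exact RingHom.congr_fun hj a
    · simp only [RingHom.comp_apply, polSub_X, coe_mapRingHom, map_X, intPol, coe_eval₂RingHom,
        eval₂_X, hjt]
  obtain ⟨r, hr, hrρ⟩ := hjρ
  have h1 : (g.map (mapRingHom ek)).eval₂ (intPol U F) (mkG U r) = 0 := by
    rw [eval₂_map, hrρ, ← hjp, ← hom_eval₂, h0, map_zero]
  obtain ⟨p, hp⟩ := exists_intPol_of_integral U F _ (hg.map _) r hr h1
  have hpR : (eval₂RingHom (cstG U) (ttG U)).comp (mapRingHom (Subfield.subtype _)) =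
      intPol U F := by
    ext
    · simp [intPol]
    · simp [intPol]
  have hR : (mapRingHom e).IsIntegralElem (p.map (Subfield.subtype _)) := by
    refine ⟨g.map (mapRingHom k.subtype), hg.map _, eval₂_cstG_injective U ?_⟩
    rw [eval₂_map, ← coe_eval₂RingHom, hom_eval₂, map_zero, ← coe_mapRingHom,
      ← RingHom.comp_apply, hpR, hp, mapRingHom_comp]
    have h2 : (Subfield.subtype _).comp ek = e.comp k.subtype := rfl
    rw [← h2, ← mapRingHom_comp, ← RingHom.comp_assoc, hpR, ← eval₂_map]
    exact h1
  have hc (l : ℕ) : ∃ d : k, ek d = p.coeff l := by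
    obtain ⟨d, hd⟩ := mem_range_of_isIntegralElem e (isIntegralElem_coeff e hR l)
    rw [coeff_map] at hd
    refine ⟨⟨d, ?_⟩, Subtype.ext hd⟩
    rw [hkdef, Subfield.mem_comap, hd]
    exact (p.coeff l).2
  obtain ⟨Q, hQ⟩ : ∃ Q : k[X], Q.map ek = p := by
    rw [← mem_lifts, lifts_iff_coeff_lifts]
    exact hc
  have h3 : polSub k Q = ρ := j.injective (by
    rw [← hrρ, ← hp, ← hQ]
    exact RingHom.congr_fun hjp Q)
  rw [← h3]
  exact polSub_mem_ratSub k Q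
end

theorem exists_finset_mem_ratSub {D : Type*} [Field D] (x : Wf D) (hx : x ∈ ratSub (⊤ : Subfield D)) :
    ∃ A : Finset D, ∀ k : Subfield D, (∀ a ∈ A, a ∈ k) → x ∈ ratSub k := by
  classical
  obtain ⟨y, rfl⟩ := mem_ratSub_iff.1 hx
  obtain ⟨p, q, -, rfl⟩ := IsFractionRing.div_surjective (A := (⊤ : Subfield D)[X]) y
  refine ⟨(Finset.range (p.natDegree + 1)).image (fun l => (p.coeff l : D)) ∪
    (Finset.range (q.natDegree + 1)).image (fun l => (q.coeff l : D)), fun k hk => ?_⟩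
  rw [map_div₀, fracSub_algebraMap, fracSub_algebraMap, polSub_eq_sum _ p (Nat.lt_succ_self _),
    polSub_eq_sum _ q (Nat.lt_succ_self _)]
  refine div_mem (sum_mem fun l hl => mul_mem (cst_mem_ratSub (hk _ ?_)) (pow_mem (tt_mem_ratSub k) _))
    (sum_mem fun l hl => mul_mem (cst_mem_ratSub (hk _ ?_)) (pow_mem (tt_mem_ratSub k) _))
  · exact Finset.mem_union_left _ (Finset.mem_image_of_mem _ hl)
  · exact Finset.mem_union_right _ (Finset.mem_image_of_mem _ hl)

theorem eq_zero_of_sum_pow {L : Type*} [Field L] {k : Subfield L} {s : L} {n : ℕ}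
    (hn : n ≤ (minpoly k s).natDegree) (c : ℕ → L) (hc : ∀ l, c l ∈ k)
    (h : ∑ l ∈ Finset.range n, c l * s ^ l = 0) : ∀ l < n, c l = 0 := by
  intro l hl
  by_contra h0
  have hne : (∑ l ∈ Finset.range n, monomial l (⟨c l, hc l⟩ : k)) ≠ 0 := fun h1 => h0 (by
    have := congrArg (fun p => p.coeff l) h1
    simpa [finsetSum_coeff, coeff_monomial, hl] using congrArg Subtype.val this)
  have hdeg := minpoly.degree_le_of_ne_zero k s hne (by
    rw [map_sum, ← h]
    exact Finset.sum_congr rfl fun i _ => aeval_monomial _)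
  have h2 : (∑ l ∈ Finset.range n, monomial l (⟨c l, hc l⟩ : k)).natDegree < n := by
    have h3 : 0 < n := by omega
    refine (natDegree_sum_le_of_forall_le (n := n - 1) _ _ fun i hi => ?_).trans_lt (by omega)
    rw [Finset.mem_range] at hi
    exact (natDegree_monomial_le _).trans (by omega)
  have h3 := natDegree_le_natDegree hdeg
  omega

theorem natDegree_minpoly_ratSub {D : Type*} [Field D] [CharZero D] [IsAlgClosed D]
    {k : Subfield D} (hk : ∀ d : D, IsAlgebraic k d) {s : Wf D}
    (hs : ∀ a, cst D a ∈ adj (ratSub k) s → a ∈ k) :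
    (minpoly (ratSub k) s).natDegree ≤ (minpoly (ratSub (⊤ : Subfield D)) s).natDegree := by
  classical
  by_contra! hlt
  have hk' (d : D) : IsAlgebraic (⊤ : Subfield D) d := isAlgebraic_comap_top (RingHom.id D) d
  set P := minpoly (ratSub (⊤ : Subfield D)) s with hP
  have hPm : P.Monic := minpoly.monic (isAlgebraic_ratSub hk' s).isIntegral
  choose A hA using fun l => exists_finset_mem_ratSub (P.coeff l : Wf D) (P.coeff l).2
  obtain ⟨a, ha, hadj⟩ := exists_primitive k
    ((Finset.range (P.natDegree + 1)).biUnion A) fun x _ => hk x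
  have hAa (l : ℕ) (hl : l < P.natDegree + 1) : (P.coeff l : Wf D) ∈ adj (ratSub k) (cst D a) := by
    have h1 : (P.coeff l : Wf D) ∈ ratSub (adj k a) := hA l _ fun b hb => by
      rw [mem_adj, hadj]
      exact IntermediateField.subset_adjoin _ _ (by
        simp only [Finset.coe_biUnion, Set.mem_iUnion]
        exact ⟨l, by simpa using hl, hb⟩)
    refine (adj_le ?_ (le_adj _ _ (tt_mem_ratSub k)) : ratSub (adj k a) ≤ _) h1
    rw [Subfield.map_le_iff_le_comap]
    exact adj_le (fun x hx => le_adj _ _ (cst_mem_ratSub hx)) (self_mem_adj (ratSub k) (cst D a))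
  -- `cst D a` has the same degree over `ratSub k` and over `adj (ratSub k) s` as `a` over `k`
  have hcom : (adj (ratSub k) s).comap (cst D) = k :=
    le_antisymm hs fun x hx => le_adj _ _ (cst_mem_ratSub hx)
  have hcom' : (ratSub k).comap (cst D) = k :=
    le_antisymm (fun x => mem_of_cst_mem_ratSub) fun x hx => cst_mem_ratSub hx
  have hdM := natDegree_minpoly_comap (cst D) (adj (ratSub k) s) a
  have hdk := natDegree_minpoly_comap (cst D) (ratSub k) a
  rw [hcom] at hdM
  rw [hcom'] at hdk
  obtain ⟨-, hdM⟩ := hdM ha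
  obtain ⟨hai, hdk⟩ := hdk ha
  have hrep (l : ℕ) : ∃ c : ℕ → ratSub k, l < P.natDegree + 1 → (P.coeff l : Wf D) =
      ∑ i ∈ Finset.range (minpoly k a).natDegree, (c i : Wf D) * cst D a ^ i := by
    by_cases hl : l < P.natDegree + 1
    · obtain ⟨c, hc⟩ := eq_sum_of_mem_adj (minpoly (ratSub k) (cst D a))
        (minpoly.monic hai.isIntegral) (minpoly.aeval _ _) (hAa l hl)
      rw [hdk] at hc
      exact ⟨c, fun _ => hc⟩
    · exact ⟨0, fun h => absurd h hl⟩
  choose c hc using hrep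
  have hsum : ∑ i ∈ Finset.range (minpoly k a).natDegree,
      (∑ l ∈ Finset.range (P.natDegree + 1), (c l i : Wf D) * s ^ l) * cst D a ^ i = 0 := by
    have h0 : aeval s P = 0 := minpoly.aeval _ _
    rw [aeval_eq_sum_range] at h0
    rw [← h0]
    simp_rw [Finset.sum_mul]
    rw [Finset.sum_comm]
    refine Finset.sum_congr rfl fun l hl => ?_
    rw [Subfield.smul_def, smul_eq_mul, hc l (Finset.mem_range.1 hl), Finset.sum_mul]
    exact Finset.sum_congr rfl fun i _ => by ring
  have h1 := eq_zero_of_sum_pow hdM.ge _ (fun i => sum_mem fun l _ =>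
    mul_mem (le_adj _ _ (c l i).2) (pow_mem (self_mem_adj _ _) _)) hsum
  have h2 (i : ℕ) (hi : i < (minpoly k a).natDegree) : (c P.natDegree i : Wf D) = 0 :=
    eq_zero_of_sum_pow (n := P.natDegree + 1) hlt (fun l => (c l i : Wf D)) (fun l => (c l i).2)
      (h1 i hi) _ (Nat.lt_succ_self _)
  have h3 := hc P.natDegree (Nat.lt_succ_self _)
  rw [Finset.sum_eq_zero fun i hi => by rw [h2 i (Finset.mem_range.1 hi), zero_mul],
    hPm.coeff_natDegree] at h3
  simp at h3

end

section
open Polynomial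

theorem isAlgebraic_of_subfield_le {L : Type*} [Field L] {k k' : Subfield L} (h : k ≤ k') {x : L}
    (hx : IsAlgebraic k x) : IsAlgebraic k' x := by
  obtain ⟨p, hp, h0⟩ := hx
  refine ⟨p.map (Subfield.inclusion h), (Polynomial.map_ne_zero_iff
    (Subfield.inclusion h).injective).2 hp, ?_⟩
  rw [← h0, aeval_def, aeval_def, eval₂_map]
  rfl

theorem eventually_mem_of_cst_mem_adj {ι K D : Type*} [Field K] {U : Ultrafilter ι} [Field D]
    [CharZero D] [IsAlgClosed D] {e : D →+* UPow U K} {j : Wf D →+* UPow U (Wf K)}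
    (hj : j.comp (cst D) = (cstG U).comp e) (hjt : j (tt D) = ttG U) (F : Subfield K)
    (hk : ∀ d : D, IsAlgebraic ((internal U fun _ => F).comap e) d) (s : Wf D)
    (hs : ∀ a, cst D a ∈ adj (ratSub ((internal U fun _ => F).comap e)) s →
      a ∈ (internal U fun _ => F).comap e) (s' : ι → Wf K) (hs' : mkG U s' = j s) :
    ∀ᶠ i in (U : Filter ι), ∀ a, cst K a ∈ adj (ratSub F) (s' i) → a ∈ F := by
  by_contra hcon
  rw [← Ultrafilter.eventually_not] at hcon
  push Not at hcon
  have hex (i : ι) : ∃ a, (∃ a, cst K a ∈ adj (ratSub F) (s' i) ∧ a ∉ F) →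
      cst K a ∈ adj (ratSub F) (s' i) ∧ a ∉ F := by
    by_cases h : ∃ a, cst K a ∈ adj (ratSub F) (s' i) ∧ a ∉ F
    · exact ⟨_, fun _ => h.choose_spec⟩
    · exact ⟨0, fun h' => absurd h' h⟩
  choose a ha using hex
  have hcF := comap_internal_ratSub hj hjt F hk
  have htop (d : D) : d ∈ (internal U fun _ => (⊤ : Subfield K)).comap e := by
    obtain ⟨f, hf⟩ := exists_mkG U (e d)
    exact ⟨f, fun _ => trivial, hf⟩
  have htop' : (internal U fun _ => (⊤ : Subfield K)).comap e = ⊤ :=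
    eq_top_iff.2 fun d _ => htop d
  have hkt (d : D) : IsAlgebraic (⊤ : Subfield D) d := isAlgebraic_comap_top (RingHom.id D) d
  have hcT := comap_internal_ratSub hj hjt ⊤ (by rw [htop']; exact hkt)
  rw [htop'] at hcT
  have halg := isAlgebraic_ratSub hk s
  have hdF := natDegree_minpoly_comap j (internal U fun _ => ratSub F) s
  have hdT := natDegree_minpoly_comap j (internal U fun _ => ratSub (⊤ : Subfield K)) s
  rw [hcF] at hdF
  rw [hcT] at hdT
  obtain ⟨hsF, hdF⟩ := hdF halg
  obtain ⟨-, hdT⟩ := hdT (isAlgebraic_ratSub hkt s)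
  have hle : (minpoly (internal U fun _ => ratSub F) (j s)).natDegree ≤
      (minpoly (internal U fun _ => ratSub (⊤ : Subfield K)) (j s)).natDegree := by
    rw [hdF, hdT]
    exact natDegree_minpoly_ratSub hk hs
  have hr : mkG U (fun i => cst K (a i)) ∈ adj (internal U fun _ => ratSub F) (j s) := by
    rw [← hs', mkG_mem_adj_internal (by rwa [hs'])]
    filter_upwards [hcon] with i hi using (ha i hi).1
  have hrT : mkG U (fun i => cst K (a i)) ∈ internal U fun _ => ratSub (⊤ : Subfield K) :=
    ⟨_, fun i => cst_mem_ratSub trivial, rfl⟩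
  obtain ⟨c, hc⟩ := eq_sum_of_mem_adj (minpoly (internal U fun _ => ratSub F) (j s))
    (minpoly.monic hsF.isIntegral) (minpoly.aeval _ _) hr
  have hmono := internal_mono (U := U) (F := fun _ => ratSub F) (F' := fun _ => ratSub (⊤ : Subfield K))
    fun _ => ratSub_mono le_top
  have hpos := minpoly.natDegree_pos hsF.isIntegral
  set m := (minpoly (internal U fun _ => ratSub F) (j s)).natDegree with hm
  have hzero := eq_zero_of_sum_pow hle
    (fun l => (c l : UPow U (Wf K)) - if l = 0 then mkG U (fun i => cst K (a i)) else 0)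
    (fun l => sub_mem (hmono (c l).2) (by split_ifs; exacts [hrT, zero_mem _])) (by
      simp_rw [sub_mul, Finset.sum_sub_distrib]
      rw [← hc, sub_eq_zero]
      simp [hpos])
  have h0 := hzero 0 hpos
  rw [if_pos rfl, sub_eq_zero] at h0
  have hrF : mkG U (fun i => cst K (a i)) ∈ internal U fun _ => ratSub F := h0 ▸ (c 0).2
  rw [mkG_mem_internal] at hrF
  obtain ⟨i, hi, hi'⟩ := (hcon.and hrF).exists
  exact (ha i hi).2 (mem_of_cst_mem_ratSub hi')

theorem exists_diagonal {V : Ultrafilter ℕ} (hV : (V : Filter ℕ) ≤ Filter.atTop)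
    (P : ℕ → ℕ → Prop) (h : ∀ n, ∀ᶠ i in (V : Filter ℕ), P n i) :
    ∃ N : ℕ → ℕ, ∀ n, ∀ᶠ i in (V : Filter ℕ), n ≤ N i ∧ P (N i) i := by
  classical
  refine ⟨fun i => Nat.findGreatest (fun n => P n i) i, fun n => ?_⟩
  filter_upwards [h n, hV (Filter.eventually_ge_atTop n)] with i hi hn
  exact ⟨Nat.le_findGreatest hn hi, Nat.findGreatest_spec (P := fun n => P n i) hn hi⟩

theorem eval₂_eq_zero_of_notMem_range {D M : Type*} [Field D] [IsAlgClosed D] [Field M]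
    (e : D →+* M) (c : M) (hc : ∀ d, e d ≠ c) (p : D[X]) (hp : p.eval₂ e c = 0) : p = 0 := by
  by_contra h0
  let := e.toAlgebra
  have h1 : IsAlgebraic D c := ⟨p, h0, hp⟩
  obtain ⟨d, hd⟩ := mem_range_of_isIntegralElem e h1.isIntegral
  exact hc d hd

end

section

variable {F : Subfield Qbar} {V : Ultrafilter ℕ} {D : Type*} [Field D]

/-- The nonstandard version of a subfield of `Qbar`. -/
abbrev star (V : Ultrafilter ℕ) (F : Subfield Qbar) : Subfield (UPow V Qbar) :=
  internal V fun _ => F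

/-- One step of the back-and-forth argument. -/
theorem exists_extension [CharZero D] [IsAlgClosed D] [Countable D] (hF : SpecProp F)
    (hV : (V : Filter ℕ) ≤ Filter.atTop) (e₁ e₂ : D →+* UPow V Qbar)
    (h12 : ∀ x, e₁ x ∈ star V F ↔ e₂ x ∈ star V F)
    (hk : ∀ d : D, IsAlgebraic ((star V F).comap e₁) d) (c : UPow V Qbar) (hc : c ∈ star V F)
    (hcn : ∀ d, e₁ d ≠ c) (z : UPow V Qbar) :
    ∃ e₁' e₂' : Wf D →+* UPow V Qbar, e₁'.comp (cst D) = e₁ ∧ e₂'.comp (cst D) = e₂ ∧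
      e₁' (tt D) = c ∧ e₂' (tt D) ≠ z ∧ (∀ x, e₁' x ∈ star V F ↔ e₂' x ∈ star V F) ∧
      ∀ d : Wf D, IsAlgebraic ((star V F).comap e₁') d := by
  classical
  have hkk : (star V F).comap e₂ = (star V F).comap e₁ := by
    ext x; exact (h12 x).symm
  obtain ⟨e, he, hec⟩ := exists_lift e₁ c (eval₂_eq_zero_of_notMem_range e₁ c hcn)
  have he' (d : D) : e (cst D d) = e₁ d := RingHom.congr_fun he d
  have hle : ratSub ((star V F).comap e₁) ≤ (star V F).comap e := by
    refine adj_le ?_ ?_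
    · rintro _ ⟨a, ha, rfl⟩
      rw [Subfield.mem_comap, he']
      exact ha
    · rwa [Subfield.mem_comap, hec]
  obtain ⟨j, hj, hjt⟩ := exists_map_ultrapower e₂
  have hcF := comap_internal_ratSub hj hjt F (by rw [hkk]; exact hk)
  rw [hkk] at hcF
  choose J hJ using fun x => exists_mkG V (j x)
  choose J₂ hJ₂ using fun d => exists_mkG V (e₂ d)
  obtain ⟨z', rfl⟩ := exists_mkG V z
  obtain ⟨en, hen⟩ := exists_surjective_nat (Wf D)
  let S (n : ℕ) : Finset (Wf D) := (Finset.range (n + 1)).image en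
  have hprim (n : ℕ) : ∃ s, s ∈ (star V F).comap e ∧
      ∀ x ∈ S n, x ∈ (star V F).comap e → x ∈ adj (ratSub ((star V F).comap e₁)) s := by
    obtain ⟨s, -, hs⟩ := exists_primitive (ratSub ((star V F).comap e₁))
      ((S n).filter fun x => x ∈ (star V F).comap e) fun x _ => isAlgebraic_ratSub hk x
    have h1 : adj (ratSub ((star V F).comap e₁)) s ≤ (star V F).comap e := by
      rw [adj, hs, IntermediateField.adjoin_toSubfield, Subfield.closure_le]
      rintro x (⟨y, rfl⟩ | hx)
      · exact hle y.2
      · exact (Finset.mem_filter.1 hx).2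
    refine ⟨s, h1 (self_mem_adj _ _), fun x hx hx' => ?_⟩
    rw [mem_adj, hs]
    exact IntermediateField.subset_adjoin _ _ (Finset.mem_coe.2 (Finset.mem_filter.2 ⟨hx, hx'⟩))
  choose s hsF hsS using hprim
  let P (n i : ℕ) : Prop := (∀ x ∈ S n, J x i ∈ adj (ratSub F) (J (s n) i) ↔ e x ∈ star V F) ∧
    (∀ a, cst Qbar a ∈ adj (ratSub F) (J (s n) i) → a ∈ F) ∧
    (∀ x ∈ S n, ∀ y ∈ S n, J (x + y) i = J x i + J y i ∧ J (x * y) i = J x i * J y i) ∧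
    (∀ x ∈ S n, ∀ d, cst D d = x → J x i = cst Qbar (J₂ d i)) ∧ J (tt D) i = tt Qbar
  have hP (n : ℕ) : ∀ᶠ i in (V : Filter ℕ), P n i := by
    refine Filter.Eventually.and ?_ (Filter.Eventually.and ?_ (Filter.Eventually.and ?_
      (Filter.Eventually.and ?_ ?_)))
    · rw [Filter.eventually_all_finset]
      intro x hx
      have h1 := mem_adj_iff_eventually j (ratSub F) (by rw [hcF]; exact isAlgebraic_ratSub hk)
        (s n) x _ _ (hJ _) (hJ x)
      rw [hcF] at h1
      have h2 : x ∈ adj (ratSub ((star V F).comap e₁)) (s n) ↔ e x ∈ star V F :=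
        ⟨fun h => adj_le hle (hsF n) h, hsS n x hx⟩
      rw [h2] at h1
      by_cases h3 : e x ∈ star V F
      · filter_upwards [h1.2 h3] with i hi using iff_of_true hi h3
      · rw [← not_iff_not, ← Ultrafilter.eventually_not] at h1
        filter_upwards [h1.2 h3] with i hi using iff_of_false hi h3
    · refine eventually_mem_of_cst_mem_adj hj hjt F (by rw [hkk]; exact hk) (s n) ?_ _ (hJ _)
      rw [hkk]
      intro a ha
      have h1 := adj_le hle (hsF n) ha
      rwa [Subfield.mem_comap, he'] at h1
    · rw [Filter.eventually_all_finset]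
      intro x _
      rw [Filter.eventually_all_finset]
      intro y _
      refine Filter.Eventually.and ?_ ?_
      · exact (mkG_eq V).1 (by rw [hJ, map_add, ← hJ, ← hJ, ← map_add]; rfl)
      · exact (mkG_eq V).1 (by rw [hJ, map_mul, ← hJ, ← hJ, ← map_mul]; rfl)
    · rw [Filter.eventually_all_finset]
      intro x _
      by_cases hx : ∃ d, cst D d = x
      · obtain ⟨d, rfl⟩ := hx
        have h1 := (mkG_eq V).1 ((hJ (cst D d)).trans ((RingHom.congr_fun hj d).trans
          ((congrArg (cstG V) (hJ₂ d).symm).trans (cstG_mkG V (J₂ d)))))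
        filter_upwards [h1] with i hi d' hd'
        rw [hi, (cst D).injective hd']
      · exact Filter.Eventually.of_forall fun i d hd => absurd ⟨d, hd⟩ hx
    · exact (mkG_eq V).1 ((hJ _).trans hjt)
  obtain ⟨N, hN⟩ := exists_diagonal hV P hP
  have hex (i : ℕ) : ∃ h : Wf Qbar → Qbar, P (N i) i →
      IsPartHom ((S (N i)).image fun x => J x i) h ∧ (∀ x ∈ (S (N i)).image fun x => J x i,
        h x ∈ F ↔ x ∈ adj (ratSub F) (J (s (N i)) i)) ∧ h (tt Qbar) ≠ z' i := by
    by_cases hi : P (N i) i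
    · obtain ⟨h, hh⟩ := hF _ hi.2.1 ((S (N i)).image fun x => J x i) (z' i)
      exact ⟨h, fun _ => hh⟩
    · exact ⟨fun _ => 0, fun h => absurd h hi⟩
  choose h hh using hex
  have hS (x : Wf D) : ∃ n, ∀ m, n ≤ m → x ∈ S m := by
    obtain ⟨n, rfl⟩ := hen x
    exact ⟨n, fun m hm => Finset.mem_image_of_mem _ (Finset.mem_range.2 (by omega))⟩
  have hev (x y : Wf D) : ∀ᶠ i in (V : Filter ℕ), x ∈ S (N i) ∧ y ∈ S (N i) ∧ P (N i) i := by
    obtain ⟨n, hn⟩ := hS x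
    obtain ⟨m, hm⟩ := hS y
    filter_upwards [hN (max n m)] with i hi
    exact ⟨hn _ ((le_max_left _ _).trans hi.1), hm _ ((le_max_right _ _).trans hi.1), hi.2⟩
  have hcst (d : D) : mkG V (fun i => h i (J (cst D d) i)) = e₂ d := by
    rw [← hJ₂, mkG_eq]
    filter_upwards [hev (cst D d) 0] with i hi
    exact (hh i hi.2.2).1.1 _ (Finset.mem_image_of_mem _ hi.1) _
      (hi.2.2.2.2.2.1 _ hi.1 _ rfl).symm
  let e₂' : Wf D →+* UPow V Qbar :=
    { toFun := fun x => mkG V fun i => h i (J x i)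
      map_one' := by rw [← map_one (cst D), hcst, map_one]
      map_zero' := by rw [← map_zero (cst D), hcst, map_zero]
      map_add' := fun x y => by
        rw [← map_add, mkG_eq]
        filter_upwards [hev x y] with i hi
        rw [(hi.2.2.2.2.1 x hi.1 y hi.2.1).1]
        exact ((hh i hi.2.2).1.2 _ (Finset.mem_image_of_mem _ hi.1) _
          (Finset.mem_image_of_mem _ hi.2.1)).1
      map_mul' := fun x y => by
        rw [← map_mul, mkG_eq]
        filter_upwards [hev x y] with i hi
        rw [(hi.2.2.2.2.1 x hi.1 y hi.2.1).2]
        exact ((hh i hi.2.2).1.2 _ (Finset.mem_image_of_mem _ hi.1) _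
          (Finset.mem_image_of_mem _ hi.2.1)).2 }
  refine ⟨e, e₂', he, RingHom.ext hcst, hec, ?_, fun x => ?_, fun d =>
    isAlgebraic_of_subfield_le hle (isAlgebraic_ratSub hk d)⟩
  · change ¬ mkG V (fun i => h i (J (tt D) i)) = _
    rw [mkG_eq, ← Ultrafilter.eventually_not]
    filter_upwards [hev 0 0] with i hi
    rw [hi.2.2.2.2.2.2]
    exact (hh i hi.2.2).2.2
  · change _ ↔ mkG V (fun i => h i (J x i)) ∈ _
    have h1 : ∀ᶠ i in (V : Filter ℕ), h i (J x i) ∈ F ↔ e x ∈ star V F := by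
      filter_upwards [hev x x] with i hi
      rw [(hh i hi.2.2).2.1 _ (Finset.mem_image_of_mem _ hi.1), hi.2.2.1 x hi.1]
    rw [mkG_mem_internal, Filter.eventually_congr h1]
    simp

end

section

variable {F : Subfield Qbar} {V : Ultrafilter ℕ}

/-- Two embeddings of `D` in the ultrapower of `Qbar` that identify algebraically closed
substructures of the pair formed by the ultrapowers of `Qbar` and `F`. -/
def IsPartialIso (F : Subfield Qbar) (V : Ultrafilter ℕ) {D : Type} [Field D]
    (e₁ e₂ : D →+* UPow V Qbar) : Prop :=
  (∀ x, e₁ x ∈ star V F ↔ e₂ x ∈ star V F) ∧ ∀ d : D, IsAlgebraic ((star V F).comap e₁) d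

theorem IsPartialIso.symm {D : Type} [Field D] {e₁ e₂ : D →+* UPow V Qbar}
    (h : IsPartialIso F V e₁ e₂) : IsPartialIso F V e₂ e₁ := by
  refine ⟨fun x => (h.1 x).symm, ?_⟩
  have : (star V F).comap e₂ = (star V F).comap e₁ := by
    ext x; exact (h.1 x).symm
  rw [this]
  exact h.2

/-- The condition that a partial isomorphism maps `v` to `w`. -/
def Matches {D : Type} [Field D] (e₁ e₂ : D →+* UPow V Qbar) (v w : ℕ → F) : Prop :=
  ∃ d, e₁ d = mkG V (fun i => (v i : Qbar)) ∧ e₂ d = mkG V fun i => (w i : Qbar)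

theorem snoc_eval {n : ℕ} (xs : Fin n → ℕ → F) (y : ℕ → F) (i : ℕ) :
    (fun l => (Fin.snoc xs y : Fin (n + 1) → ℕ → F) l i) = Fin.snoc (fun l => xs l i) (y i) := by
  funext l
  refine Fin.lastCases ?_ (fun l => ?_) l <;> simp

variable [FirstOrder.Ring.CompatibleRing F] {α : Type*}

theorem matches_realize_term {D : Type} [Field D] (e₁ e₂ : D →+* UPow V Qbar) (v w : α → ℕ → F)
    (h : ∀ a, Matches e₁ e₂ (v a) (w a))
    (t : Language.ring.Term α) :
    Matches e₁ e₂ (fun i => t.realize fun a => v a i) fun i => t.realize fun a => w a i := by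
  induction t with
  | var a => exact h a
  | func f ts ih =>
    choose d hd₁ hd₂ using ih
    cases f with
    | add =>
      refine ⟨d 0 + d 1, ?_, ?_⟩
      · rw [map_add, hd₁, hd₁, ← map_add]
        congr 1; ext i
        simp [Language.Term.realize, FirstOrder.Ring.CompatibleRing.funMap_add]
      · rw [map_add, hd₂, hd₂, ← map_add]
        congr 1; ext i
        simp [Language.Term.realize, FirstOrder.Ring.CompatibleRing.funMap_add]
    | mul =>
      refine ⟨d 0 * d 1, ?_, ?_⟩
      · rw [map_mul, hd₁, hd₁, ← map_mul]
        congr 1; ext i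
        simp [Language.Term.realize, FirstOrder.Ring.CompatibleRing.funMap_mul]
      · rw [map_mul, hd₂, hd₂, ← map_mul]
        congr 1; ext i
        simp [Language.Term.realize, FirstOrder.Ring.CompatibleRing.funMap_mul]
    | neg =>
      refine ⟨- d 0, ?_, ?_⟩
      · rw [map_neg, hd₁, ← map_neg]
        congr 1; ext i
        simp [Language.Term.realize, FirstOrder.Ring.CompatibleRing.funMap_neg]
      · rw [map_neg, hd₂, ← map_neg]
        congr 1; ext i
        simp [Language.Term.realize, FirstOrder.Ring.CompatibleRing.funMap_neg]
    | zero =>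
      refine ⟨0, ?_, ?_⟩ <;>
      · rw [map_zero, ← map_zero (mkG V)]
        congr 1; ext i
        simp [Language.Term.realize, FirstOrder.Ring.CompatibleRing.funMap_zero]
    | one =>
      refine ⟨1, ?_, ?_⟩ <;>
      · rw [map_one, ← map_one (mkG V)]
        congr 1; ext i
        simp [Language.Term.realize, FirstOrder.Ring.CompatibleRing.funMap_one]

theorem realize_iff_of_isPartialIso (hF : SpecProp F) (hV : (V : Filter ℕ) ≤ Filter.atTop) {n : ℕ}
    (φ : Language.ring.BoundedFormula α n) : ∀ {D : Type} [Field D] [CharZero D] [IsAlgClosed D]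
    [Countable D] {e₁ e₂ : D →+* UPow V Qbar}, IsPartialIso F V e₁ e₂ →
    ∀ {v w : α → ℕ → F} {xs ys : Fin n → ℕ → F}, (∀ a, Matches e₁ e₂ (v a) (w a)) →
    (∀ l, Matches e₁ e₂ (xs l) (ys l)) →
    ((∀ᶠ i in (V : Filter ℕ), φ.Realize (fun a => v a i) fun l => xs l i) ↔
      ∀ᶠ i in (V : Filter ℕ), φ.Realize (fun a => w a i) fun l => ys l i) := by
  induction φ with
  | falsum => intros; rfl
  | equal t₁ t₂ =>
    intro D _ _ _ _ e₁ e₂ _ v w xs ys hv hx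
    have hm : ∀ a, Matches e₁ e₂ (Sum.elim v xs a) (Sum.elim w ys a) := by
      rintro (a | a)
      exacts [hv a, hx a]
    obtain ⟨d₁, h₁, h₁'⟩ := matches_realize_term e₁ e₂ _ _ hm t₁
    obtain ⟨d₂, h₂, h₂'⟩ := matches_realize_term e₁ e₂ _ _ hm t₂
    have hel {n : ℕ} (v : α → ℕ → F) (xs : Fin n → ℕ → F) (i : ℕ) :
        (fun a => Sum.elim v xs a i) = Sum.elim (fun a => v a i) fun l => xs l i := by
      funext a; cases a <;> rfl
    simp_rw [hel] at h₁ h₁' h₂ h₂'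
    have h3 : e₁ d₁ = e₁ d₂ ↔ e₂ d₁ = e₂ d₂ := by rw [e₁.injective.eq_iff, e₂.injective.eq_iff]
    rw [h₁, h₁', h₂, h₂', mkG_eq, mkG_eq] at h3
    simp only [Subtype.coe_inj] at h3
    exact h3
  | rel R => exact isEmptyElim R
  | imp φ ψ ih₁ ih₂ =>
    intro D _ _ _ _ e₁ e₂ h v w xs ys hv hx
    simp_rw [Language.BoundedFormula.realize_imp]
    rw [Ultrafilter.eventually_imp, Ultrafilter.eventually_imp, ih₁ h hv hx, ih₂ h hv hx]
  | all φ ih =>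
    have key {D : Type} [Field D] [CharZero D] [IsAlgClosed D] [Countable D]
        {e₁ e₂ : D →+* UPow V Qbar} (h : IsPartialIso F V e₁ e₂) {v w : α → ℕ → F}
        {xs ys : Fin _ → ℕ → F} (hv : ∀ a, Matches e₂ e₁ (v a) (w a))
        (hx : ∀ l, Matches e₂ e₁ (xs l) (ys l))
        (hall : ∀ᶠ i in (V : Filter ℕ), φ.all.Realize (fun a => v a i) fun l => xs l i) :
        ∀ᶠ i in (V : Filter ℕ), φ.all.Realize (fun a => w a i) fun l => ys l i := by
      by_contra hcon
      rw [← Ultrafilter.eventually_not] at hcon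
      simp_rw [Language.BoundedFormula.realize_all] at hcon hall
      push Not at hcon
      have hex (i : ℕ) : ∃ y : F, (∃ y, ¬ φ.Realize (fun a => w a i)
          (Fin.snoc (fun l => ys l i) y)) →
          ¬ φ.Realize (fun a => w a i) (Fin.snoc (fun l => ys l i) y) := by
        by_cases hi : ∃ y, ¬ φ.Realize (fun a => w a i) (Fin.snoc (fun l => ys l i) y)
        · exact ⟨_, fun _ => hi.choose_spec⟩
        · exact ⟨0, fun h => absurd h hi⟩
      choose y hy using hex
      have hfin {D : Type} [Field D] [CharZero D] [IsAlgClosed D] [Countable D]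
          {e₁ e₂ : D →+* UPow V Qbar} (h : IsPartialIso F V e₁ e₂)
          (hv : ∀ a, Matches e₂ e₁ (v a) (w a)) (hx : ∀ l, Matches e₂ e₁ (xs l) (ys l))
          (hd : ∃ d, e₁ d = mkG V fun i => (y i : Qbar)) : False := by
        obtain ⟨d, hd⟩ := hd
        obtain ⟨y', hy', hd'⟩ := (h.1 d).1 (hd ▸ ⟨_, fun i => (y i).2, rfl⟩)
        have h1 := ih h.symm (xs := Fin.snoc xs fun i => ⟨y' i, hy' i⟩) (ys := Fin.snoc ys y)
          hv (fun l => by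
            refine Fin.lastCases ?_ (fun l => ?_) l
            · simp only [Fin.snoc_last]
              exact ⟨d, hd'.symm, hd⟩
            · simpa only [Fin.snoc_castSucc] using hx l)
        simp_rw [snoc_eval] at h1
        obtain ⟨i, hi, hi'⟩ := ((h1.1 (hall.mono fun i hi => hi _)).and hcon).exists
        exact hy i hi' hi
      by_cases hd : ∃ d, e₁ d = mkG V fun i => (y i : Qbar)
      · exact hfin h hv hx hd
      · push Not at hd
        obtain ⟨e₁', e₂', rfl, rfl, hc, -, h12, halg⟩ := exists_extension hF hV e₁ e₂ h.1 h.2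
          (mkG V fun i => (y i : Qbar)) ⟨_, fun i => (y i).2, rfl⟩ hd 0
        have hmat {v w : ℕ → F} : Matches (e₂'.comp (cst D)) (e₁'.comp (cst D)) v w →
            Matches e₂' e₁' v w := fun ⟨d, hd⟩ => ⟨cst D d, hd⟩
        exact hfin ⟨h12, halg⟩ (fun a => hmat (hv a)) (fun l => hmat (hx l)) ⟨tt D, hc⟩
    intro D _ _ _ _ e₁ e₂ h v w xs ys hv hx
    have hsw {v w : ℕ → F} : Matches e₁ e₂ v w → Matches e₂ e₁ w v := fun ⟨d, h, h'⟩ => ⟨d, h', h⟩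
    exact ⟨key h.symm hv hx, key h (fun a => hsw (hv a)) fun l => hsw (hx l)⟩

end

section
open Polynomial

instance : Countable Qbar := by
  have := @Algebra.IsAlgebraic.cardinalMk_le_max ℚ _ _ Qbar _ _ _ _
    (AlgebraicClosure.isAlgebraic ℚ)
  exact Cardinal.mk_le_aleph0_iff.1 (this.trans (by simp))

theorem eval₂_swap {R S : Type*} [CommRing R] [CommRing S] (e : R →+* S) (x z : S) (P : R[X][X]) :
    (Bivariate.swap P).eval₂ (eval₂RingHom e x) z = P.eval₂ (eval₂RingHom e z) x := by
  have h : (eval₂RingHom (eval₂RingHom e x) z).comp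
      ((Bivariate.swap (R := R) : R[X][X] ≃ₐ[R] R[X][X]) : R[X][X] →+* R[X][X]) =
      eval₂RingHom (eval₂RingHom e z) x := by
    ext <;> simp [Bivariate.swap_C_C, Bivariate.swap_X, Bivariate.swap_Y]
  exact RingHom.congr_fun h P

/-- The exchange property of algebraic closure. -/
theorem mem_range_exchange {D M : Type*} [Field D] [Field M] {e : D →+* M} {x z : M}
    {ex ez : Wf D →+* M} (hex : ex.comp (cst D) = e) (hx : ex (tt D) = x)
    (hez : ez.comp (cst D) = e) (hz : ez (tt D) = z) (h : ∃ d, ez d = x) : ∃ d, ex d = z := by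
  have hcomp {f : Wf D →+* M} (hf : f.comp (cst D) = e) :
      f.comp (algebraMap D[X] (Wf D)) = eval₂RingHom e (f (tt D)) := by
    refine ringHom_ext (fun a => ?_) ?_
    · rw [coe_eval₂RingHom, eval₂_C, ← hf]
      rfl
    · rw [coe_eval₂RingHom, eval₂_X]
      rfl
  obtain ⟨d, rfl⟩ := h
  obtain ⟨P, hP, h0⟩ := Algebra.IsAlgebraic.isAlgebraic (R := D[X]) d
  have h1 : P.eval₂ (eval₂RingHom e z) (ez d) = 0 := by
    rw [← hz, ← hcomp hez, ← hom_eval₂, ← aeval_def, h0, map_zero]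
  rw [← eval₂_swap, ← hx, ← hcomp hex, ← eval₂_map] at h1
  by_contra! hcon
  have h2 := eval₂_eq_zero_of_notMem_range ex z hcon _ h1
  rw [Polynomial.map_eq_zero_iff algebraMap_Wf_injective, EmbeddingLike.map_eq_zero_iff] at h2
  exact hP h2

theorem exists_mkG_notMem_range {V : Ultrafilter ℕ} (hV : (V : Filter ℕ) ≤ Filter.atTop)
    {D : Type*} [Countable D] [Nonempty D] {L : Type*} [Field L] (e : D → UPow V L)
    {K : Set L} (hK : K.Infinite) : ∃ x : ℕ → L, (∀ i, x i ∈ K) ∧ ∀ d, e d ≠ mkG V x := by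
  classical
  choose f hf using fun d => exists_mkG V (e d)
  obtain ⟨en, hen⟩ := exists_surjective_nat D
  choose x hx hx' using fun i =>
    hK.exists_notMem_finset ((Finset.range (i + 1)).image fun n => f (en n) i)
  refine ⟨x, hx, fun d h => ?_⟩
  obtain ⟨n, rfl⟩ := hen d
  rw [← hf, mkG_eq] at h
  obtain ⟨i, hi, hni⟩ := (h.and (hV (Filter.eventually_ge_atTop n))).exists
  exact hx' i (Finset.mem_image.2 ⟨n, Finset.mem_range.2 (by omega), hi⟩)

theorem eventually_mem_iff_of_definable {F K : Subfield Qbar} {V : Ultrafilter ℕ} (hF : SpecProp F)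
    (hV : (V : Filter ℕ) ≤ Filter.atTop) (hK : DefinableIn F {x : F | (x : Qbar) ∈ K})
    {D : Type} [Field D] [CharZero D] [IsAlgClosed D] [Countable D] {e₁ e₂ : D →+* UPow V Qbar}
    (he : IsPartialIso F V e₁ e₂) (hc : ∀ a : F, Matches e₁ e₂ (fun _ => a) fun _ => a)
    {x y : ℕ → F} (hxy : Matches e₁ e₂ x y) :
    (∀ᶠ i in (V : Filter ℕ), (x i : Qbar) ∈ K) ↔ ∀ᶠ i in (V : Filter ℕ), (y i : Qbar) ∈ K := by
  let := FirstOrder.Ring.compatibleRingOfRing F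
  obtain ⟨φ, hφ⟩ := Set.definable_iff_exists_formula_sum.1 hK
  have h1 (x : F) : (x : Qbar) ∈ K ↔
      φ.Realize (Sum.elim (fun a : (Set.univ : Set F) => (a : F)) fun _ => x) := by
    have := congrArg (fun s => (fun _ => x) ∈ s) hφ
    exact this.to_iff
  have h2 := realize_iff_of_isPartialIso hF hV φ he
    (v := Sum.elim (fun (a : (Set.univ : Set F)) _ => (a : F)) fun _ => x)
    (w := Sum.elim (fun (a : (Set.univ : Set F)) _ => (a : F)) fun _ => y)
    (xs := Fin.elim0) (ys := Fin.elim0) (by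
      rintro (a | a)
      exacts [hc a, hxy]) fun l => l.elim0
  have h3 (x : ℕ → F) (i : ℕ) :
      φ.Realize (Sum.elim (fun a : (Set.univ : Set F) => (a : F)) fun _ => x i) ↔
      Language.BoundedFormula.Realize φ (fun a =>
        (Sum.elim (fun (a : (Set.univ : Set F)) _ => (a : F)) fun _ => x :
          (Set.univ : Set F) ⊕ Fin 1 → ℕ → F) a i) fun l => (Fin.elim0 l : ℕ → F) i := by
    rw [Language.Formula.Realize]
    refine Eq.to_iff (congrArg₂ _ ?_ (Subsingleton.elim _ _))
    funext a
    cases a <;> rfl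
  simp_rw [h1, h3]
  exact h2

theorem not_definable_of_specProp {F K : Subfield Qbar} (hF : SpecProp F) (hKF : K ≤ F)
    (hne : F ≠ K) : ¬ DefinableIn F {x : F | (x : Qbar) ∈ K} := by
  intro hdef
  obtain ⟨a, haF, haK⟩ : ∃ a ∈ F, a ∉ K := by
    by_contra! h
    exact hne (le_antisymm h hKF)
  have ha0 : a ≠ 0 := by rintro rfl; exact haK (zero_mem K)
  let V : Ultrafilter ℕ := Filter.hyperfilter ℕ
  have hV : (V : Filter ℕ) ≤ Filter.atTop := Nat.hyperfilter_le_atTop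
  have hKinf : (K : Set Qbar).Infinite := by
    refine Set.infinite_of_injective_forall_mem (f := fun n : ℕ => (n : Qbar)) Nat.cast_injective
      fun n => natCast_mem K n
  obtain ⟨x, hxK, hx⟩ := exists_mkG_notMem_range hV (constG V) hKinf
  obtain ⟨ex, hex, hext⟩ := exists_lift (constG V (K := Qbar)) (mkG V x)
    (eval₂_eq_zero_of_notMem_range (constG V) (mkG V x) hx)
  obtain ⟨y, hyK, hy⟩ := exists_mkG_notMem_range hV ex hKinf
  set z := mkG V x + constG V a * mkG V y with hz
  have hexa (b : Qbar) : ex (cst Qbar b) = constG V b := RingHom.congr_fun hex b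
  have hca : constG V a ≠ 0 := (_root_.map_ne_zero _).2 ha0
  have hzx : ∀ d, ex d ≠ z := by
    intro d hd
    refine hy ((d - tt Qbar) / cst Qbar a) ?_
    rw [map_div₀, map_sub, hd, hext, hexa, hz]
    field_simp
    ring
  obtain ⟨ez, hez, hezt⟩ := exists_lift (constG V) z (eval₂_eq_zero_of_notMem_range (constG V) z
    fun d hd => hzx (cst Qbar d) ((hexa d).trans hd))
  have hxz : ∀ d, ez d ≠ mkG V x := by
    intro d hd
    obtain ⟨d', hd'⟩ := mem_range_exchange hex hext hez hezt ⟨d, hd⟩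
    exact hzx d' hd'
  have heza (b : Qbar) : ez (cst Qbar b) = constG V b := RingHom.congr_fun hez b
  have hcF (b : Qbar) (hb : b ∈ F) : constG V b ∈ star V F := ⟨fun _ => b, fun _ => hb, rfl⟩
  have hxF : mkG V x ∈ star V F := ⟨x, fun i => hKF (hxK i), rfl⟩
  have hyF : mkG V y ∈ star V F := ⟨y, fun i => hKF (hyK i), rfl⟩
  have hle : ratSub F ≤ (star V F).comap ez := by
    refine adj_le ?_ ?_
    · rintro _ ⟨b, hb, rfl⟩
      rw [Subfield.mem_comap, heza]
      exact hcF b hb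
    · rw [Subfield.mem_comap, hezt]
      exact add_mem hxF (mul_mem (hcF a haF) hyF)
  obtain ⟨e₁, e₂, he₁, he₂, ht₁, ht₂, h12, halg⟩ := exists_extension hF hV ez ez (fun _ => Iff.rfl)
    (fun d => isAlgebraic_of_subfield_le hle (isAlgebraic_ratSub (isAlgebraic_subfield_Qbar F) d))
    (mkG V x) hxF hxz (mkG V x)
  have hc₁ (d : Wf Qbar) : e₁ (cst _ d) = ez d := RingHom.congr_fun he₁ d
  have hc₂ (d : Wf Qbar) : e₂ (cst _ d) = ez d := RingHom.congr_fun he₂ d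
  have hconst (b : F) : Matches e₁ e₂ (fun _ => b) fun _ => b :=
    ⟨cst _ (cst _ b), (hc₁ _).trans (heza b), (hc₂ _).trans (heza b)⟩
  have hpart : IsPartialIso F V e₁ e₂ := ⟨h12, halg⟩
  have hst (u : ℕ → Qbar) (hu : ∀ i, u i ∈ K) (d : Wf (Wf Qbar)) (hd : e₁ d = mkG V u) :
      ∃ u', mkG V u' = e₂ d ∧ ∀ᶠ i in (V : Filter ℕ), u' i ∈ K := by
    have h1 : e₁ d ∈ star V F := hd ▸ ⟨u, fun i => hKF (hu i), rfl⟩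
    obtain ⟨u', hu', h⟩ := (h12 d).1 h1
    refine ⟨u', h, (eventually_mem_iff_of_definable hF hV hdef hpart hconst
      (x := fun i => ⟨u i, hKF (hu i)⟩) (y := fun i => ⟨u' i, hu' i⟩) ⟨d, hd, h.symm⟩).1
      (Filter.Eventually.of_forall hu)⟩
  obtain ⟨x', hx', hx'K⟩ := hst x hxK _ ht₁
  obtain ⟨y', hy', hy'K⟩ := hst y hyK ((cst _ (tt Qbar) - tt _) / cst _ (cst _ a)) (by
    rw [map_div₀, map_sub, hc₁, hc₁, ht₁, heza, hezt, hz]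
    field_simp
    ring)
  have hsum : mkG V (fun i => x i + a * y i) = mkG V fun i => x' i + a * y' i := by
    change mkG V x + constG V a * mkG V y = mkG V x' + constG V a * mkG V y'
    rw [hx', hy', map_div₀, map_sub, hc₂, hc₂, heza, hezt, ← hz]
    field_simp
    ring
  rw [mkG_eq] at hsum
  have hxx : ∀ᶠ i in (V : Filter ℕ), ¬ x' i = x i := by
    rw [Ultrafilter.eventually_not, ← mkG_eq, hx']
    exact ht₂
  obtain ⟨i, ⟨⟨h1, h2⟩, h3⟩, h4⟩ := (((hx'K.and hy'K).and hsum).and hxx).exists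
  have hyy : y i - y' i ≠ 0 := by
    intro h
    rw [sub_eq_zero.1 h] at h3
    exact h4 (add_right_cancel h3).symm
  refine haK ?_
  rw [show a = (x' i - x i) / (y i - y' i) by
    rw [eq_div_iff hyy]
    linear_combination h3]
  exact div_mem (sub_mem h1 (hxK i)) (sub_mem (hyK i) h2)

end

/-- For every number field `K` (a subfield of `Q̄` finite-dimensional over `ℚ`),
the set of subfields `F ⊇ K` of `Q̄` in which the subset `K` is definable
(by a first-order formula in the language of rings with parameters from `F`)
is meager in the space `𝓔` of all subfields of `Q̄`. -/
theorem meager_numberField_definable (K : Subfield Qbar) (hK : FiniteDimensional ℚ K) :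
    IsMeagre {F : Subfield Qbar |
      K ≤ F ∧ DefinableIn F {x : F | (x : Qbar) ∈ K}} := by
  have : NumberField K := ⟨⟩
  refine ((isMeagre_singleton K).union isMeagre_not_specProp).mono ?_
  rintro F ⟨hKF, hdef⟩
  by_cases hFK : F = K
  · exact Or.inl hFK
  · exact Or.inr fun hF => not_definable_of_specProp hF hKF hFK hdef
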